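/- arXiv:2604.11682 — 2 statements merged into one kernel-verified Lean document; each statement's English description precedes it below -/
import Mathlib

section
/- Few upward neighbours at each vertex. Under assumptions (A1) and (A2), for every x ∈ [N], every constant c > 1 and every ν > 0, defining D_x^{nc+} := #( S_1^+(x) ∖ S_1^cyc(x) ), with ν-high probability D_x^{nc+} ≤ c · (ν/(1−δ)) · log N / log log N. -/
open MeasureTheory Real

namespace GRG

variable {N : ℕ}

/-! ### Generic graph-theoretic definitions over an adjacency relation on `Fin N` -/

/-- The degree of a vertex with respect to an adjacency relation. -/
noncomputable def degA (A : Fin N → Fin N → Prop) (x : Fin N) : ℕ :=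
  {y | A x y}.ncard

/-- The strict total order `≺`: `x ≺ y` iff `D_x < D_y`, or `D_x = D_y` and `x > y`. -/
def precA (A : Fin N → Fin N → Prop) (x y : Fin N) : Prop :=
  degA A x < degA A y ∨ (degA A x = degA A y ∧ y < x)

/-- `γ 0, γ 1, …, γ l` is a path for the adjacency relation `A`. -/
def IsPathOn (A : Fin N → Fin N → Prop) (l : ℕ) (γ : ℕ → Fin N) : Prop :=
  ∀ i < l, A (γ i) (γ (i + 1))

/-- A path of length `l` is simple: all vertices distinct except possibly endpoints. -/
def IsSimplePath (l : ℕ) (γ : ℕ → Fin N) : Prop :=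
  ∀ i j, i < j → j ≤ l → ¬(i = 0 ∧ j = l) → γ i ≠ γ j

/-- Two paths are edge-disjoint. -/
def EdgeDisjoint (l l' : ℕ) (γ γ' : ℕ → Fin N) : Prop :=
  ∀ i < l, ∀ j < l',
    ¬((γ i = γ' j ∧ γ (i + 1) = γ' (j + 1)) ∨ (γ i = γ' (j + 1) ∧ γ (i + 1) = γ' j))

/-- `S_1^cyc(x)`: neighbours of `x` that start a simple cycle through `x`
of length at most `2r+1`. -/
def S1cycA (A : Fin N → Fin N → Prop) (r : ℕ) (x : Fin N) : Set (Fin N) :=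
  {y | A x y ∧ ∃ l γ, 3 ≤ l ∧ l ≤ 2 * r + 1 ∧ γ 0 = x ∧ γ 1 = y ∧ γ l = x ∧
    IsPathOn A l γ ∧ IsSimplePath l γ}

/-- `S_1^du(x)`: neighbours `y ∉ S_1^cyc(x)` of `x` that have a neighbour
`z ∉ S_1^cyc(y)` with `y ≺ x ≺ z`. -/
def S1duA (A : Fin N → Fin N → Prop) (r : ℕ) (x : Fin N) : Set (Fin N) :=
  {y | A x y ∧ y ∉ S1cycA A r x ∧ precA A y x ∧
    ∃ z, A y z ∧ z ∉ S1cycA A r y ∧ precA A x z}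

/-- Adjacency in the graph `G^nc` (after removing the cycle-creating edges). -/
def AdjNCA (A : Fin N → Fin N → Prop) (r : ℕ) (x y : Fin N) : Prop :=
  A x y ∧ y ∉ S1cycA A r x ∧ x ∉ S1cycA A r y

/-- Adjacency in the pruned graph `G^p` (after further removing the down-up edges). -/
def AdjPA (A : Fin N → Fin N → Prop) (r : ℕ) (x y : Fin N) : Prop :=
  AdjNCA A r x y ∧ y ∉ S1duA A r x ∧ x ∉ S1duA A r y

/-- Degree in the pruned graph. -/
noncomputable def degPA (A : Fin N → Fin N → Prop) (r : ℕ) (x : Fin N) : ℕ :=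
  {y | AdjPA A r x y}.ncard

/-- `S_1^{p−}(x)`: pruned-graph neighbours of `x` that are smaller than `x` for `≺`. -/
def S1pmA (A : Fin N → Fin N → Prop) (r : ℕ) (x : Fin N) : Set (Fin N) :=
  {y | AdjPA A r x y ∧ precA A y x}

/-- `D_x^{p−}`. -/
noncomputable def degPmA (A : Fin N → Fin N → Prop) (r : ℕ) (x : Fin N) : ℕ :=
  (S1pmA A r x).ncard

/-- `Sib^−(x)`: the smaller siblings of `x` (children of the parent of `x`
that are smaller than `x`). -/
def SibmA (A : Fin N → Fin N → Prop) (r : ℕ) (x : Fin N) : Set (Fin N) :=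
  {y | ∃ p, AdjPA A r x p ∧ precA A x p ∧ AdjPA A r p y ∧ precA A y p ∧ precA A y x}

/-- The normalization constant `Z_x` (note `2/0 = 0` in Lean, so this agrees with the
convention `Z_x = 2` when `Sib^−(x) = ∅`). -/
noncomputable def ZxA (A : Fin N → Fin N → Prop) (r : ℕ) (x : Fin N) : ℝ :=
  2 + 2 / (SibmA A r x).ncard

/-- The indicator vector of a set of vertices. -/
noncomputable def indVec (S : Set (Fin N)) : Fin N → ℝ :=
  S.indicator 1

/-- The approximate eigenvector `u_σ(x)`. -/
noncomputable def uVecA (A : Fin N → Fin N → Prop) (r : ℕ) (σ : ℝ) (x : Fin N) :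
    Fin N → ℝ := fun y =>
  (Real.sqrt (ZxA A r x))⁻¹ *
    (indVec {x} y + σ * (Real.sqrt (degPmA A r x))⁻¹ * indVec (S1pmA A r x) y -
      indVec (SibmA A r x) y / (SibmA A r x).ncard)

/-- The star vector `v_σ(x)`. -/
noncomputable def vVecA (A : Fin N → Fin N → Prop) (r : ℕ) (σ : ℝ) (x : Fin N) :
    Fin N → ℝ := fun y =>
  (Real.sqrt 2)⁻¹ *
    (indVec {x} y + σ * (Real.sqrt (degPmA A r x))⁻¹ * indVec (S1pmA A r x) y)

/-- Euclidean scalar product on `ℝ^N`. -/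
noncomputable def dotR (f g : Fin N → ℝ) : ℝ := ∑ y, f y * g y

/-- The Euclidean (`ℓ² → ℓ²`) operator norm of an `N × N` real matrix. -/
noncomputable def opNorm (M : Matrix (Fin N) (Fin N) ℝ) : ℝ :=
  ‖Matrix.toEuclideanCLM (𝕜 := ℝ) M‖

open Classical in
/-- The adjacency matrix of the pruned graph. -/
noncomputable def adjMatrixPA (A : Fin N → Fin N → Prop) (r : ℕ) :
    Matrix (Fin N) (Fin N) ℝ := fun x y => if AdjPA A r x y then 1 else 0

/-- The threshold `ξ_ν`. -/
noncomputable def xi (ν δ : ℝ) (N : ℕ) : ℝ :=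
  3 * (ν + 1) * (2 - 3 * δ) / ((1 - δ) * (1 - 2 * δ)) *
    (Real.log N / Real.log (Real.log N))

/-- The set `V_ν^{(h)}` of high-degree vertices. -/
def VhA (A : Fin N → Fin N → Prop) (ν δ : ℝ) : Set (Fin N) :=
  {x | xi ν δ N ≤ (degA A x : ℝ)}

/-- The projection `Π^p` onto the span of the vectors `u_σ(x)`, `x ∈ V_ν^{(h)}`. -/
noncomputable def PiPA (A : Fin N → Fin N → Prop) (r : ℕ) (ν δ : ℝ) :
    Matrix (Fin N) (Fin N) ℝ :=
  ∑ x : Fin N, Set.indicator (VhA A ν δ) (fun _ => (1 : ℝ)) x •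
    (Matrix.vecMulVec (uVecA A r 1 x) (uVecA A r 1 x) +
      Matrix.vecMulVec (uVecA A r (-1) x) (uVecA A r (-1) x))

/-- The block-diagonal approximation `Â`. -/
noncomputable def AhatA (A : Fin N → Fin N → Prop) (r : ℕ) (ν δ : ℝ) :
    Matrix (Fin N) (Fin N) ℝ :=
  (∑ x : Fin N, Set.indicator (VhA A ν δ) (fun _ => (1 : ℝ)) x •
    (Real.sqrt (degPmA A r x) •
      (Matrix.vecMulVec (uVecA A r 1 x) (uVecA A r 1 x) -
        Matrix.vecMulVec (uVecA A r (-1) x) (uVecA A r (-1) x)))) +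
  (1 - PiPA A r ν δ) * adjMatrixPA A r * (1 - PiPA A r ν δ)

/-! ### The generalized random graph (GRG) model -/

/-- Index set of potential edges. -/
abbrev EdgeIdx (N : ℕ) := {p : Fin N × Fin N // p.1 < p.2}

/-- The edge probabilities `p_{xy} = w_x w_y / (Σ_z w_z + w_x w_y)`. -/
noncomputable def pGRG (w : Fin N → ℝ) (x y : Fin N) : ℝ :=
  w x * w y / ((∑ z, w z) + w x * w y)

/-- Bernoulli measure with parameter `p` on `Bool`. -/
noncomputable def bern (p : ℝ) : Measure Bool :=
  ENNReal.ofReal p • Measure.dirac true + ENNReal.ofReal (1 - p) • Measure.dirac false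

instance (p : ℝ) : IsFiniteMeasure (bern p) := by
  constructor
  simp only [bern, Measure.coe_add, Measure.coe_smul, Pi.add_apply, Pi.smul_apply,
    smul_eq_mul, measure_univ, mul_one]
  exact ENNReal.add_lt_top.mpr ⟨ENNReal.ofReal_lt_top, ENNReal.ofReal_lt_top⟩

/-- The law of the GRG: independent Bernoulli edge indicators. -/
noncomputable def grgMeasure (w : Fin N → ℝ) : Measure (EdgeIdx N → Bool) :=
  Measure.pi fun e => bern (pGRG w e.val.1 e.val.2)

/-- The (random) adjacency matrix. -/
noncomputable def adjMatrix (ω : EdgeIdx N → Bool) : Matrix (Fin N) (Fin N) ℝ :=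
  fun x y =>
    if h : x < y then (if ω ⟨(x, y), h⟩ then 1 else 0)
    else if h' : y < x then (if ω ⟨(y, x), h'⟩ then 1 else 0)
    else 0

/-- The (random) adjacency relation. -/
def Adj (ω : EdgeIdx N → Bool) (x y : Fin N) : Prop := adjMatrix ω x y = 1

/-- The (random) degree `D_x`. -/
noncomputable def deg (ω : EdgeIdx N → Bool) (x : Fin N) : ℕ := degA (Adj ω) x

/-- The first empirical moment `m_1`. -/
noncomputable def m1 (w : Fin N → ℝ) : ℝ := (∑ x, w x) / N

/-- The second empirical moment `m_2`. -/
noncomputable def m2 (w : Fin N → ℝ) : ℝ := (∑ x, w x ^ 2) / N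

/-- The expected degree `d_x = E[D_x]`. -/
noncomputable def dExp (w : Fin N → ℝ) (x : Fin N) : ℝ :=
  ∫ ω, (deg ω x : ℝ) ∂(grgMeasure w)

/-- The set `W_{λ,η}` of resonant vertices. -/
def resonant (ω : EdgeIdx N → Bool) (lam η : ℝ) : Set (Fin N) :=
  {x | |Real.sqrt (deg ω x) - lam| ≤ η}

/-- The set `V*_{ν,η}` of isolated vertices. -/
noncomputable def Vstar (w : Fin N → ℝ) (ν η : ℝ) : Set (Fin N) :=
  {x | (4 * ν / 9) * Real.log N ≤ dExp w x ∧
    ∀ y, y ≠ x →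
      max (4 * Real.sqrt (ν * Real.log N * dExp w x) +
            4 * Real.sqrt (ν * Real.log N * dExp w y))
          (16 * η ^ 2) ≤ |dExp w x - dExp w y|}

end GRG


namespace GRG

lemma pGRG_nonneg {N : ℕ} (w : Fin N → ℝ) (hw : ∀ x, 0 < w x) (x y : Fin N) :
    0 ≤ pGRG w x y := by
  unfold pGRG
  have h1 : 0 ≤ ∑ z, w z := Finset.sum_nonneg fun z _ => (hw z).le
  have h2 : 0 < w x * w y := mul_pos (hw x) (hw y)
  positivity

lemma sum_pos' {N : ℕ} (w : Fin N → ℝ) (hw : ∀ x, 0 < w x) (x : Fin N) : 0 < ∑ z, w z :=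
  Finset.sum_pos (fun z _ => hw z) ⟨x, Finset.mem_univ x⟩

lemma pGRG_le {N : ℕ} (w : Fin N → ℝ) (hw : ∀ x, 0 < w x) (x y : Fin N) :
    pGRG w x y ≤ w x * w y / ∑ z, w z := by
  unfold pGRG
  have h1 := sum_pos' w hw x
  have h2 : 0 < w x * w y := mul_pos (hw x) (hw y)
  apply div_le_div_of_nonneg_left h2.le h1
  linarith

lemma pGRG_le_one {N : ℕ} (w : Fin N → ℝ) (hw : ∀ x, 0 < w x) (x y : Fin N) :
    pGRG w x y ≤ 1 := by
  unfold pGRG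
  have h1 := sum_pos' w hw x
  have h2 : 0 < w x * w y := mul_pos (hw x) (hw y)
  rw [div_le_one (by positivity)]
  linarith

lemma pGRG_comm {N : ℕ} (w : Fin N → ℝ) (x y : Fin N) : pGRG w x y = pGRG w y x := by
  unfold pGRG
  rw [mul_comm (w x)]

lemma bern_prob (p : ℝ) (h0 : 0 ≤ p) (h1 : p ≤ 1) : IsProbabilityMeasure (bern p) := by
  constructor
  simp only [bern, Measure.coe_add, Measure.coe_smul, Pi.add_apply, Pi.smul_apply,
    smul_eq_mul, measure_univ, mul_one]
  rw [← ENNReal.ofReal_add h0 (by linarith)]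
  simp

lemma bern_true (p : ℝ) : bern p {true} = ENNReal.ofReal p := by
  simp [bern]

lemma bern_integral (p : ℝ) (h0 : 0 ≤ p) (h1 : p ≤ 1) (f : Bool → ℝ) :
    ∫ b, f b ∂(bern p) = p * f true + (1 - p) * f false := by
  unfold bern
  have i1 : IsFiniteMeasure (ENNReal.ofReal p • Measure.dirac true) :=
    Measure.smul_finite _ ENNReal.ofReal_ne_top
  have i2 : IsFiniteMeasure (ENNReal.ofReal (1 - p) • Measure.dirac false) :=
    Measure.smul_finite _ ENNReal.ofReal_ne_top
  rw [integral_add_measure Integrable.of_finite Integrable.of_finite]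
  simp [integral_smul_measure, h0, h1]

lemma grg_prob {N : ℕ} (w : Fin N → ℝ) (hw : ∀ x, 0 < w x) :
    IsProbabilityMeasure (grgMeasure w) := by
  have : ∀ e : EdgeIdx N, IsProbabilityMeasure (bern (pGRG w e.val.1 e.val.2)) := fun e =>
    bern_prob _ (pGRG_nonneg w hw _ _) (pGRG_le_one w hw _ _)
  unfold grgMeasure
  infer_instance

/-- The probability that all edges of a finite set are present. -/
lemma grg_all {N : ℕ} (w : Fin N → ℝ) (hw : ∀ x, 0 < w x) (S : Finset (EdgeIdx N)) :
    (grgMeasure w).real {ω | ∀ e ∈ S, ω e = true} = ∏ e ∈ S, pGRG w e.val.1 e.val.2 := by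
  have : ∀ e : EdgeIdx N, IsProbabilityMeasure (bern (pGRG w e.val.1 e.val.2)) := fun e =>
    bern_prob _ (pGRG_nonneg w hw _ _) (pGRG_le_one w hw _ _)
  have hset : {ω : EdgeIdx N → Bool | ∀ e ∈ S, ω e = true} =
      Set.pi Set.univ (fun e => if e ∈ S then {true} else Set.univ) := by
    ext ω
    simp only [Set.mem_ofPred_eq, Set.mem_pi, Set.mem_univ, true_implies]
    refine forall_congr' fun e => ?_
    by_cases he : e ∈ S <;> simp [he]
  rw [hset, Measure.real, grgMeasure, Measure.pi_pi, ENNReal.toReal_prod,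
    ← Finset.prod_subset (Finset.subset_univ S)]
  · refine Finset.prod_congr rfl fun e he => ?_
    simp only [he, if_true, bern_true]
    exact ENNReal.toReal_ofReal (pGRG_nonneg w hw _ _)
  · intro e _ he
    rw [if_neg he, measure_univ, ENNReal.toReal_one]

/-- The edge joining two distinct vertices. -/
def edg {N : ℕ} (x y : Fin N) (h : x ≠ y) : EdgeIdx N :=
  ⟨(min x y, max x y), by simpa [eq_comm] using h⟩

lemma adj_iff {N : ℕ} (ω : EdgeIdx N → Bool) (x y : Fin N) (h : x ≠ y) :
    Adj ω x y ↔ ω (edg x y h) = true := by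
  unfold Adj adjMatrix edg
  rcases lt_or_gt_of_ne h with h' | h'
  · simp [h', min_eq_left h'.le, max_eq_right h'.le]
  · simp [h', not_lt.2 h'.le, min_eq_right h'.le, max_eq_left h'.le]

lemma adj_ne {N : ℕ} (ω : EdgeIdx N → Bool) (x y : Fin N) (h : Adj ω x y) : x ≠ y := by
  rintro rfl
  simp [Adj, adjMatrix] at h

lemma edg_comm {N : ℕ} (x y : Fin N) (h : x ≠ y) : edg x y h = edg y x h.symm := by
  simp [edg, min_comm, max_comm]

lemma adj_symm {N : ℕ} (ω : EdgeIdx N → Bool) (x y : Fin N) (h : Adj ω x y) : Adj ω y x := by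
  have hn := adj_ne ω x y h
  rw [adj_iff ω y x hn.symm, ← edg_comm]
  exact (adj_iff ω x y hn).1 h

lemma edg_eq {N : ℕ} {x y x' y' : Fin N} {h : x ≠ y} {h' : x' ≠ y'}
    (he : edg x y h = edg x' y' h') : (x = x' ∧ y = y') ∨ (x = y' ∧ y = x') := by
  simp only [edg, Subtype.mk.injEq, Prod.mk.injEq] at he
  obtain ⟨h1, h2⟩ := he
  rcases le_total x y with a | a <;> rcases le_total x' y' with b | b <;>
    simp [a, b] at h1 h2 <;> simp [h1, h2]

lemma pGRG_edg {N : ℕ} (w : Fin N → ℝ) (x y : Fin N) (h : x ≠ y) :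
    pGRG w (edg x y h).val.1 (edg x y h).val.2 = pGRG w x y := by
  rcases le_total x y with a | a
  · simp [edg, a]
  · simp only [edg, a, min_eq_right, max_eq_left]
    exact pGRG_comm _ _ _

/-- Probability of a spider with centre `x`. -/
lemma grg_spider {N : ℕ} (w : Fin N → ℝ) (hw : ∀ x, 0 < w x) (x : Fin N)
    (Y : Finset (Fin N)) (hx : x ∉ Y) (f : Y → Fin N) (hf : ∀ y, f y ∉ insert x Y) :
    (grgMeasure w).real {ω | ∀ y : Y, Adj ω x y ∧ Adj ω y (f y)} =
      ∏ y : Y, (pGRG w x y * pGRG w y (f y)) := by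
  have h1 : ∀ y : Y, x ≠ y := fun y h => hx (h ▸ y.2)
  have h2 : ∀ y : Y, (y : Fin N) ≠ f y := fun y h => hf y (Finset.mem_insert_of_mem (h ▸ y.2))
  let g : Y ⊕ Y → EdgeIdx N := Sum.elim (fun y => edg x y (h1 y)) (fun y => edg y (f y) (h2 y))
  have hg : Function.Injective g := by
    have hfx : ∀ y, f y ≠ x := fun y h => hf y (by simp [h])
    have hfY : ∀ y z : Y, f y ≠ z := fun y z h => hf y (by simp [h])
    rintro (a | a) (b | b) h <;> simp only [g, Sum.elim_inl, Sum.elim_inr] at h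
    · rcases edg_eq h with ⟨-, h⟩ | ⟨h, -⟩
      · rw [Subtype.ext h]
      · exact absurd h (h1 b)
    · rcases edg_eq h with ⟨h, -⟩ | ⟨h, -⟩
      · exact absurd h (h1 b)
      · exact absurd h.symm (hfx b)
    · rcases edg_eq h with ⟨h, -⟩ | ⟨-, h⟩
      · exact absurd h.symm (h1 a)
      · exact absurd h (hfx a)
    · rcases edg_eq h with ⟨h, -⟩ | ⟨h, -⟩
      · rw [Subtype.ext h]
      · exact absurd h.symm (hfY b a)
  have hset : {ω : EdgeIdx N → Bool | ∀ y : Y, Adj ω x y ∧ Adj ω y (f y)} =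
      {ω | ∀ e ∈ Finset.univ.image g, ω e = true} := by
    ext ω
    simp only [Set.mem_ofPred_eq, Finset.mem_image, Finset.mem_univ, true_and,
      forall_exists_index, forall_apply_eq_imp_iff, Sum.forall, g, Sum.elim_inl, Sum.elim_inr,
      forall_and]
    refine and_congr (forall_congr' fun y => adj_iff _ _ _ _) (forall_congr' fun y => adj_iff _ _ _ _)
  rw [hset, grg_all w hw, Finset.prod_image (fun a _ b _ h => hg h), Fintype.prod_sum_type,
    ← Finset.prod_mul_distrib]
  simp only [g, Sum.elim_inl, Sum.elim_inr, pGRG_edg]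

/-- Expected number of spiders. -/
lemma grg_EY {N : ℕ} (w : Fin N → ℝ) (hw : ∀ x, 0 < w x) (x : Fin N)
    (Y : Finset (Fin N)) (hx : x ∉ Y) (m : ℝ) (hm : 0 < m) :
    (grgMeasure w).real {ω | ∀ y ∈ Y, Adj ω x y ∧
        m ≤ ({z | z ∉ insert x Y ∧ Adj ω y z}.ncard : ℝ)} ≤
      ∏ y ∈ Y, (pGRG w x y * w y / m) := by
  classical
  have := grg_prob w hw
  set E := {ω : EdgeIdx N → Bool | ∀ y ∈ Y, Adj ω x y ∧
        m ≤ ({z | z ∉ insert x Y ∧ Adj ω y z}.ncard : ℝ)} with hE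
  let P : Finset (Y → Fin N) := Fintype.piFinset (fun _ : Y => (insert x Y)ᶜ)
  let F : (Y → Fin N) → Set (EdgeIdx N → Bool) := fun f =>
    {ω | ∀ y : Y, Adj ω x y ∧ Adj ω y (f y)}
  have key : m ^ Y.card * (grgMeasure w).real E ≤ ∑ f ∈ P, (grgMeasure w).real (F f) := by
    have h1 := mul_meas_ge_le_integral_of_nonneg (μ := grgMeasure w)
      (f := fun ω => ∑ f ∈ P, (F f).indicator (fun _ => (1 : ℝ)) ω)
      (Filter.Eventually.of_forall fun ω => Finset.sum_nonneg fun f _ =>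
        Set.indicator_nonneg (fun _ _ => zero_le_one) _) Integrable.of_finite (m ^ Y.card)
    rw [integral_finsetSum _ (fun _ _ => Integrable.of_finite)] at h1
    have h2 : ∀ f, ∫ ω, (F f).indicator (fun _ => (1 : ℝ)) ω ∂(grgMeasure w) =
        (grgMeasure w).real (F f) := fun f =>
      integral_indicator_one (Set.toFinite _).measurableSet
    simp only [h2] at h1
    refine le_trans (mul_le_mul_of_nonneg_left (measureReal_mono ?_) (by positivity)) h1
    intro ω hω
    simp only [Set.mem_ofPred_eq]
    have h3 : ∑ f ∈ P, (F f).indicator (fun _ => (1 : ℝ)) ω =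
        ((P.filter (fun f => ω ∈ F f)).card : ℝ) := by
      rw [Finset.card_filter]
      push_cast
      exact Finset.sum_congr rfl fun f _ => by simp [Set.indicator_apply]
    have h4 : P.filter (fun f => ω ∈ F f) = Fintype.piFinset (fun y : Y =>
        Finset.univ.filter (fun z => z ∉ insert x Y ∧ Adj ω y z)) := by
      ext f
      simp only [P, F, Finset.mem_filter, Fintype.mem_piFinset, Finset.mem_compl, Set.mem_ofPred_eq,
        Finset.mem_univ, true_and]
      constructor
      · rintro ⟨a, b⟩ y
        exact ⟨a y, (b y).2⟩
      · intro a
        exact ⟨fun y => (a y).1, fun y => ⟨(hω y y.2).1, (a y).2⟩⟩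
    rw [h3, h4, Fintype.card_piFinset]
    push_cast
    have h5 : m ^ Y.card = ∏ y : Y, m := by simp
    rw [h5]
    refine Finset.prod_le_prod (fun _ _ => hm.le) fun y _ => ?_
    have h6 := (hω y y.2).2
    rw [Set.ncard_eq_toFinset_card'] at h6
    refine h6.trans (le_of_eq ?_)
    congr 2
    ext z; simp
  have h2 : ∑ f ∈ P, (grgMeasure w).real (F f) ≤ ∏ y ∈ Y, (pGRG w x y * w y) := by
    calc ∑ f ∈ P, (grgMeasure w).real (F f)
        = ∑ f ∈ P, ∏ y : Y, (pGRG w x y * pGRG w y (f y)) := by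
          refine Finset.sum_congr rfl fun f hf => grg_spider w hw x Y hx f ?_
          simpa [P, Fintype.mem_piFinset] using hf
      _ = ∏ y : Y, ∑ z ∈ (insert x Y)ᶜ, (pGRG w x y * pGRG w y z) := by
          rw [Finset.prod_univ_sum]
      _ ≤ ∏ y : Y, (pGRG w x y * w y) := by
          refine Finset.prod_le_prod (fun y _ => Finset.sum_nonneg fun z _ =>
            mul_nonneg (pGRG_nonneg w hw _ _) (pGRG_nonneg w hw _ _)) fun y _ => ?_
          rw [← Finset.mul_sum]
          refine mul_le_mul_of_nonneg_left ?_ (pGRG_nonneg w hw _ _)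
          calc ∑ z ∈ (insert x Y)ᶜ, pGRG w y z ≤ ∑ z, pGRG w y z :=
                Finset.sum_le_univ_sum_of_nonneg fun z => pGRG_nonneg w hw _ _
            _ ≤ ∑ z, w y * w z / ∑ z, w z := Finset.sum_le_sum fun z _ => pGRG_le w hw _ _
            _ = w y := by
                rw [← Finset.sum_div, ← Finset.mul_sum]
                exact mul_div_cancel_right₀ _ (sum_pos' w hw x).ne'
      _ = _ := Finset.prod_coe_sort Y (fun y => pGRG w x y * w y)
  have h3 : ∏ y ∈ Y, (pGRG w x y * w y / m) = (∏ y ∈ Y, (pGRG w x y * w y)) / m ^ Y.card := by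
    rw [Finset.prod_div_distrib, Finset.prod_const]
  rw [h3, le_div_iff₀ (by positivity), mul_comm]
  exact key.trans h2

lemma triangle_cyc {N : ℕ} (ω : EdgeIdx N → Bool) (r : ℕ) (hr : 1 ≤ r) (x y z : Fin N)
    (hxy : Adj ω x y) (hyz : Adj ω y z) (hxz : Adj ω x z) : y ∈ S1cycA (Adj ω) r x := by
  refine ⟨hxy, 3, fun i => if i = 1 then y else if i = 2 then z else x, le_refl _, by omega,
    by simp, by simp, by simp, ?_, ?_⟩
  · intro i hi
    interval_cases i
    · simpa using hxy
    · simpa using hyz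
    · simpa using adj_symm _ _ _ hxz
  · have a := adj_ne _ _ _ hxy
    have b := adj_ne _ _ _ hyz
    have c := adj_ne _ _ _ hxz
    intro i j hij hj hne
    interval_cases j <;> interval_cases i <;> simp_all [ne_comm]

lemma esymm_le {N : ℕ} (q : Fin N → ℝ) (hq : ∀ y, 0 ≤ q y) (V : Finset (Fin N)) (k : ℕ)
    (Q : ℝ) (hQ : 0 < Q) (hqQ : ∑ y, q y ≤ Q) (hk : 1 ≤ k) :
    ∑ Y ∈ V.powersetCard k, ∏ y ∈ Y, q y ≤ (Real.exp 1 * Q / k) ^ k := by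
  have hk' : (0 : ℝ) < k := by exact_mod_cast hk
  set θ : ℝ := k / Q with hθ
  have hθp : 0 < θ := by positivity
  have h1 : θ ^ k * ∑ Y ∈ V.powersetCard k, ∏ y ∈ Y, q y ≤ Real.exp k := by
    calc θ ^ k * ∑ Y ∈ V.powersetCard k, ∏ y ∈ Y, q y
        = ∑ Y ∈ V.powersetCard k, ∏ y ∈ Y, (θ * q y) := by
          rw [Finset.mul_sum]
          refine Finset.sum_congr rfl fun Y hY => ?_
          rw [Finset.prod_mul_distrib, Finset.prod_const, (Finset.mem_powersetCard.1 hY).2]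
      _ ≤ ∑ Y ∈ (Finset.univ : Finset (Fin N)).powerset, ∏ y ∈ Y, (θ * q y) := by
          refine Finset.sum_le_sum_of_subset_of_nonneg (fun Y _ => by simp) fun Y _ _ =>
            Finset.prod_nonneg fun y _ => mul_nonneg hθp.le (hq y)
      _ = ∏ y, (1 + θ * q y) := (Finset.prod_one_add _).symm
      _ ≤ ∏ y, Real.exp (θ * q y) := by
          refine Finset.prod_le_prod (fun y _ => by have := mul_nonneg hθp.le (hq y); positivity)
            fun y _ => ?_
          rw [add_comm]
          exact Real.add_one_le_exp _
      _ = Real.exp (θ * ∑ y, q y) := by rw [← Real.exp_sum, Finset.mul_sum]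
      _ ≤ Real.exp k := by
          apply Real.exp_le_exp.2
          calc θ * ∑ y, q y ≤ θ * Q := mul_le_mul_of_nonneg_left hqQ hθp.le
            _ = k := by rw [hθ]; field_simp
  have h2 : (Real.exp 1 * Q / k) ^ k = Real.exp k / θ ^ k := by
    rw [hθ, div_pow, mul_pow, div_pow, ← Real.exp_nat_mul]
    field_simp
  rw [h2, le_div_iff₀ (by positivity), mul_comm]
  exact h1

lemma grg_bad {N : ℕ} (w : Fin N → ℝ) (hw : ∀ x, 0 < w x) (x : Fin N) (r : ℕ) (hr : 1 ≤ r)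
    (k : ℕ) (hk : 1 ≤ k) (m : ℝ) (hm : 1 < m) (Q : ℝ) (hQ : 0 < Q)
    (hqQ : ∑ y, pGRG w x y * w y / (m - 1) ≤ Q) :
    (grgMeasure w).real {ω | k ≤ ({y | Adj ω x y ∧ precA (Adj ω) x y} \
        S1cycA (Adj ω) r x).ncard ∧ m ≤ (degA (Adj ω) x : ℝ)} ≤ (Real.exp 1 * Q / k) ^ k := by
  classical
  have := grg_prob w hw
  have hm' : 0 < m - 1 := by linarith
  refine le_trans ?_ (esymm_le (fun y => pGRG w x y * w y / (m - 1))
    (fun y => div_nonneg (mul_nonneg (pGRG_nonneg w hw _ _) (hw y).le) hm'.le)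
    (Finset.univ.erase x) k Q hQ hqQ hk)
  let E : Finset (Fin N) → Set (EdgeIdx N → Bool) := fun Y => {ω | ∀ y ∈ Y, Adj ω x y ∧
        m - 1 ≤ ({z | z ∉ insert x Y ∧ Adj ω y z}.ncard : ℝ)}
  have hsub : {ω | k ≤ ({y | Adj ω x y ∧ precA (Adj ω) x y} \
        S1cycA (Adj ω) r x).ncard ∧ m ≤ (degA (Adj ω) x : ℝ)} ⊆
        ⋃ Y ∈ (Finset.univ.erase x).powersetCard k, E Y := by
    rintro ω ⟨h1, h2⟩
    rw [Set.ncard_eq_toFinset_card'] at h1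
    obtain ⟨Y, hYs, hYc⟩ := Finset.exists_subset_card_eq h1
    have hY : ∀ y ∈ Y, (Adj ω x y ∧ precA (Adj ω) x y) ∧ y ∉ S1cycA (Adj ω) r x := by
      intro y hy
      simpa using hYs hy
    simp only [Set.mem_iUnion]
    refine ⟨Y, ?_, ?_⟩
    · rw [Finset.mem_powersetCard]
      refine ⟨fun y hy => ?_, hYc⟩
      simpa using (adj_ne _ _ _ (hY y hy).1.1).symm
    · intro y hy
      refine ⟨(hY y hy).1.1, ?_⟩
      have hd : degA (Adj ω) x ≤ degA (Adj ω) y := by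
        rcases (hY y hy).1.2 with h | h
        · exact h.le
        · exact h.1.le
      have hsub2 : {z | Adj ω y z} ⊆ insert x {z | z ∉ insert x Y ∧ Adj ω y z} := by
        intro z hz
        by_cases hzx : z = x
        · simp [hzx]
        · refine Set.mem_insert_of_mem _ ⟨?_, hz⟩
          intro hzY
          rcases Finset.mem_insert.1 hzY with h | h
          · exact hzx h
          · exact (hY y hy).2 (triangle_cyc ω r hr x y z (hY y hy).1.1 hz (hY z h).1.1)
      have h3 : degA (Adj ω) y ≤ {z | z ∉ insert x Y ∧ Adj ω y z}.ncard + 1 :=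
        (Set.ncard_le_ncard hsub2 (Set.toFinite _)).trans (Set.ncard_insert_le _ _)
      have h4 : ((degA (Adj ω) x : ℕ) : ℝ) ≤
          ({z | z ∉ insert x Y ∧ Adj ω y z}.ncard : ℝ) + 1 := by exact_mod_cast hd.trans h3
      linarith
  refine (measureReal_mono hsub (measure_ne_top _ _)).trans ((measureReal_biUnion_finset_le _ _).trans ?_)
  refine Finset.sum_le_sum fun Y hY => ?_
  refine grg_EY w hw x Y (fun h => ?_) (m - 1) hm'
  simpa using (Finset.mem_powersetCard.1 hY).1 h

/-- Lower tail of the degree. -/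
lemma grg_lower {N : ℕ} (w : Fin N → ℝ) (hw : ∀ x, 0 < w x) (x : Fin N)
    (a d : ℝ) (hd : d ≤ ∑ y ∈ Finset.univ.erase x, pGRG w x y) :
    (grgMeasure w).real {ω | (degA (Adj ω) x : ℝ) ≤ a} ≤ Real.exp (a - d / 2) := by
  classical
  have := grg_prob w hw
  have hpr : ∀ e : EdgeIdx N, IsProbabilityMeasure (bern (pGRG w e.val.1 e.val.2)) := fun e =>
    bern_prob _ (pGRG_nonneg w hw _ _) (pGRG_le_one w hw _ _)
  let V := (Finset.univ.erase x : Finset (Fin N))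
  have hV : ∀ y : V, x ≠ y := fun y h => by have := y.2; simp [V, h] at this
  let g : V → EdgeIdx N := fun y => edg x y (hV y)
  have hg : Function.Injective g := by
    intro a b h
    rcases edg_eq h with ⟨-, h⟩ | ⟨h, -⟩
    · exact Subtype.ext h
    · exact absurd h (hV b)
  let S := Finset.univ.image g
  let φ : EdgeIdx N → Bool → ℝ := fun e b => if e ∈ S ∧ b = true then Real.exp (-1) else 1
  have hφ : ∀ ω : EdgeIdx N → Bool, ∏ e, φ e (ω e) = Real.exp (-(degA (Adj ω) x : ℝ)) := by
    intro ω
    have h1 : (degA (Adj ω) x) = (Finset.univ.filter (fun e => e ∈ S ∧ ω e = true)).card := by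
      unfold degA
      have : (Finset.univ.filter (fun e => e ∈ S ∧ ω e = true)) =
          (Finset.univ.filter (fun y : V => Adj ω x y)).image g := by
        ext e
        simp only [S, Finset.mem_filter, Finset.mem_univ, true_and, Finset.mem_image]
        constructor
        · rintro ⟨⟨y, rfl⟩, h⟩
          exact ⟨y, (adj_iff ω x y (hV y)).2 h, rfl⟩
        · rintro ⟨y, h, rfl⟩
          exact ⟨⟨y, rfl⟩, (adj_iff ω x y (hV y)).1 h⟩
      rw [this, Finset.card_image_of_injective _ hg, ← Finset.card_map (Function.Embedding.subtype _),
        ← Set.ncard_coe_finset]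
      congr 1
      ext y
      simp only [Set.mem_ofPred_eq, Finset.coe_map, Set.mem_image, Finset.mem_coe,
        Finset.mem_filter, Finset.mem_univ, true_and]
      constructor
      · intro h
        exact ⟨⟨y, by simpa [V] using (adj_ne _ _ _ h).symm⟩, h, rfl⟩
      · rintro ⟨y, h, rfl⟩
        exact h
    rw [h1]
    simp only [φ]
    rw [Finset.prod_ite]
    simp only [Finset.prod_const, one_pow, mul_one]
    rw [← Real.exp_nat_mul]
    congr 1
    ring
  have hlaplace : ∫ ω, Real.exp (-(degA (Adj ω) x : ℝ)) ∂(grgMeasure w) ≤ Real.exp (-(d / 2)) := by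
    simp only [← hφ]
    unfold grgMeasure
    rw [integral_fintype_prod_eq_prod (𝕜 := ℝ) φ]
    calc ∏ e : EdgeIdx N, ∫ b, φ e b ∂(bern (pGRG w e.val.1 e.val.2))
        ≤ ∏ e : EdgeIdx N, (if e ∈ S then Real.exp (-(pGRG w e.val.1 e.val.2 / 2)) else 1) := by
          refine Finset.prod_le_prod (fun e _ => integral_nonneg fun b => ?_) fun e _ => ?_
          · simp only [φ]; split_ifs <;> positivity
          · have h0 := pGRG_nonneg w hw e.val.1 e.val.2
            rw [bern_integral _ h0 (pGRG_le_one w hw _ _)]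
            by_cases he : e ∈ S
            · simp only [φ, he, true_and, if_true]
              have h1 := Real.add_one_le_exp (-(pGRG w e.val.1 e.val.2 / 2))
              have h2 : Real.exp (-1) ≤ 1 / 2 := by
                have := Real.exp_neg_one_lt_d9
                linarith
              simp
              nlinarith
            · simp [φ, he]
      _ = Real.exp (-((∑ y ∈ V, pGRG w x y) / 2)) := by
          rw [Finset.prod_ite_mem, Finset.univ_inter, Finset.prod_image (fun a _ b _ h => hg h),
            ← Real.exp_sum, Finset.sum_neg_distrib, ← Finset.sum_div]
          simp only [g, pGRG_edg]
          rw [Finset.sum_coe_sort V (fun y => pGRG w x y)]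
      _ ≤ _ := by
          apply Real.exp_le_exp.2
          simp only [V]
          linarith
  have h1 := mul_meas_ge_le_integral_of_nonneg (μ := grgMeasure w)
      (f := fun ω => Real.exp (-(degA (Adj ω) x : ℝ)))
      (Filter.Eventually.of_forall fun ω => (Real.exp_pos _).le) Integrable.of_finite
      (Real.exp (-a))
  have h2 : {ω : EdgeIdx N → Bool | (degA (Adj ω) x : ℝ) ≤ a} =
      {ω | Real.exp (-a) ≤ Real.exp (-(degA (Adj ω) x : ℝ))} := by
    ext ω
    simp
  rw [h2]
  have h3 : Real.exp (a - d / 2) = Real.exp (-(d / 2)) / Real.exp (-a) := by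
    rw [← Real.exp_sub]; congr 1; ring
  rw [h3, le_div_iff₀ (Real.exp_pos _), mul_comm]
  exact h1.trans hlaplace


lemma numeric_event (ν δ c C : ℝ) (hν : 0 < ν) (hδ' : δ < 1 / 3) (hc : 1 < c)
    (hC : 0 < C) : ∃ N0 : ℕ, ∀ N : ℕ, N0 ≤ N → 4 ≤ N ∧ 0 < Real.log N ∧
      1 ≤ Real.log (Real.log N) ∧ 2 ≤ ν * Real.log N ∧
      2 ≤ c * (ν / (1 - δ)) * (Real.log N / Real.log (Real.log N)) ∧
      Real.log (Real.exp 1 * (32 * Real.log (Real.log N) * (C * Real.log N ^ δ))) +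
        (1 - δ) / c * Real.log (Real.log N) ≤
      Real.log (c * (ν / (1 - δ)) * (Real.log N / Real.log (Real.log N))) := by
  have hd : 0 < 1 - δ := by linarith
  set K := c * (ν / (1 - δ)) with hK
  have hKp : 0 < K := by positivity
  have hlog : Filter.Tendsto (fun N : ℕ => Real.log N) Filter.atTop Filter.atTop :=
    Real.tendsto_log_atTop.comp tendsto_natCast_atTop_atTop
  have hll : Filter.Tendsto (fun N : ℕ => Real.log (Real.log N)) Filter.atTop Filter.atTop :=
    Real.tendsto_log_atTop.comp hlog
  have e1 : ∀ᶠ N : ℕ in Filter.atTop, 4 ≤ N := Filter.eventually_ge_atTop 4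
  have e2 := hlog.eventually (Filter.eventually_gt_atTop 0)
  have e3 := hll.eventually (Filter.eventually_ge_atTop 1)
  have e4 := hlog.eventually (Filter.eventually_ge_atTop (2 / ν))
  have e5 := hlog.eventually (Real.isLittleO_log_id_atTop.bound (show 0 < K / 2 by positivity))
  have hη : 0 < (1 - δ) * (1 - 1 / c) := by
    have : 1 / c < 1 := by rw [div_lt_one (by linarith)]; exact hc
    apply mul_pos hd; linarith
  set η := (1 - δ) * (1 - 1 / c) with hηd
  have e6 := hll.eventually (Real.isLittleO_log_id_atTop.bound (show 0 < η / 4 by positivity))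
  have e7 := hll.eventually (Filter.eventually_ge_atTop
    (2 * (1 + Real.log (32 * C) - Real.log K) / η))
  obtain ⟨N0, h⟩ := Filter.eventually_atTop.1
    (e1.and (e2.and (e3.and (e4.and (e5.and (e6.and e7))))))
  refine ⟨N0, fun N hN => ?_⟩
  obtain ⟨h1, h2, h3, h4, h5, h6, h7⟩ := h N hN
  set L := Real.log N
  set u := Real.log L with hu
  have hup : 0 < u := by linarith
  simp only [id, Real.norm_eq_abs] at h5 h6
  rw [abs_of_pos hup, abs_of_pos h2] at h5
  rw [abs_of_pos hup] at h6
  have h6' := (le_abs_self _).trans h6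
  refine ⟨h1, h2, h3, ?_, ?_, ?_⟩
  · rw [div_le_iff₀ hν] at h4; linarith
  · rw [← mul_div_assoc, le_div_iff₀ hup]; linarith
  · have hLd : 0 < L ^ δ := Real.rpow_pos_of_pos h2 δ
    have a1 : Real.log (Real.exp 1 * (32 * u * (C * L ^ δ))) =
        1 + Real.log (32 * C) + Real.log u + δ * u := by
      have : Real.exp 1 * (32 * u * (C * L ^ δ)) = Real.exp 1 * ((32 * C) * u * L ^ δ) := by ring
      rw [this, Real.log_mul (Real.exp_pos 1).ne' (by positivity), Real.log_exp,
        Real.log_mul (by positivity) hLd.ne', Real.log_mul (by positivity) hup.ne',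
        Real.log_rpow h2]
      ring
    have a2 : Real.log (K * (L / u)) = Real.log K + u - Real.log u := by
      rw [Real.log_mul hKp.ne' (by positivity), Real.log_div h2.ne' hup.ne']
      ring
    rw [a1, a2]
    rw [div_le_iff₀ hη] at h7
    have a3 : (1 - δ) / c = (1 - δ) - η := by rw [hηd]; ring
    rw [a3]
    nlinarith

set_option maxHeartbeats 1000000 in
/-- The bound at a fixed, large `N`. -/
lemma fixed_N {N : ℕ} (w : Fin N → ℝ) (hw : ∀ x, 0 < w x) (ε δ ν c C : ℝ) (hε : 0 < ε)
    (hδ : 0 < δ) (hδ' : δ < 1 / 3) (hν : 0 < ν) (hc : 1 < c) (hC : 0 < C)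
    (r : ℕ) (hr : 6 ≤ r)
    (hA1 : ∀ x, w x ≤ (N : ℝ) ^ ((1 : ℝ) / 2 - ε))
    (hA2 : (N : ℝ) ^ (-ε) ≤ m1 w)
    (hA3 : m2 w / m1 w ≤ C * Real.log N ^ δ) (h4 : 4 ≤ N) (hL : 0 < Real.log N)
    (hLL : 1 ≤ Real.log (Real.log N)) (hνL : 2 ≤ ν * Real.log N)
    (hT : 2 ≤ c * (ν / (1 - δ)) * (Real.log N / Real.log (Real.log N)))
    (hmain : Real.log (Real.exp 1 * (32 * Real.log (Real.log N) * (C * Real.log N ^ δ))) +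
        (1 - δ) / c * Real.log (Real.log N) ≤
      Real.log (c * (ν / (1 - δ)) * (Real.log N / Real.log (Real.log N)))) (x : Fin N) :
    (grgMeasure w).real {ω | ¬
          ((({y | Adj ω x y ∧ precA (Adj ω) x y} \ S1cycA (Adj ω) r x).ncard : ℝ)) ≤
            c * (ν / (1 - δ)) * (Real.log N / Real.log (Real.log N))} ≤
      2 * (N : ℝ) ^ (-ν) := by
  have := grg_prob w hw
  have hd : 0 < 1 - δ := by linarith
  set L := Real.log N with hLdef
  set u := Real.log L with hu
  set T := c * (ν / (1 - δ)) * (L / u) with hTdef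
  have hup : 0 < u := by linarith
  have hTp : 0 < T := by linarith
  have hNr : (4 : ℝ) ≤ N := by exact_mod_cast h4
  have hN0 : (0 : ℝ) < N := by linarith
  have hLd : 0 < L ^ δ := Real.rpow_pos_of_pos hL δ
  set Q := 32 * u * (C * L ^ δ) with hQ
  have hQp : 0 < Q := by positivity
  set k := ⌊T⌋₊ + 1 with hk
  have hTk : T < k := by rw [hk]; push_cast; exact Nat.lt_floor_add_one T
  have hkp : (0 : ℝ) < k := by linarith
  have hNν : (N : ℝ) ^ (-ν) = Real.exp (-(ν * L)) := by
    rw [Real.rpow_def_of_pos hN0]; congr 1; ring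
  have hSig := sum_pos' w hw x
  -- the main estimate
  have hest : (Real.exp 1 * Q / k) ^ k ≤ (N : ℝ) ^ (-ν) := by
    have hpos : 0 < Real.exp 1 * Q / k := by positivity
    rw [hNν, ← Real.exp_log hpos, ← Real.exp_nat_mul]
    apply Real.exp_le_exp.2
    rw [Real.log_div (by positivity) hkp.ne']
    have h1 : Real.log T ≤ Real.log k := Real.log_le_log hTp hTk.le
    have h2 : (1 - δ) / c * u ≤ Real.log k - Real.log (Real.exp 1 * Q) := by linarith
    have h3 : 0 ≤ (1 - δ) / c * u := by positivity
    have h5 : T * ((1 - δ) / c * u) = ν * L := by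
      rw [hTdef]; field_simp
    nlinarith [mul_le_mul hTk.le h2 h3 hkp.le]
  -- the bound on the bad event given a lower bound on the degree
  have hbad : ∀ m : ℝ, 2 ≤ m → w x ≤ 16 * u * m →
      (grgMeasure w).real {ω | k ≤ ({y | Adj ω x y ∧ precA (Adj ω) x y} \
        S1cycA (Adj ω) r x).ncard ∧ m ≤ (degA (Adj ω) x : ℝ)} ≤ (N : ℝ) ^ (-ν) := by
    intro m hm hwm
    refine (grg_bad w hw x r (by omega) k (by omega) m (by linarith) Q hQp ?_).trans hest
    have hm1 : 0 < m - 1 := by linarith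
    have h1 : m2 w / m1 w = (∑ y, w y ^ 2) / ∑ y, w y := by
      unfold m1 m2
      rw [div_div_div_cancel_right₀ hN0.ne']
    have h2 : 0 ≤ (∑ y, w y ^ 2) / ∑ y, w y :=
      div_nonneg (Finset.sum_nonneg fun y _ => sq_nonneg _) hSig.le
    rw [h1] at hA3
    calc ∑ y, pGRG w x y * w y / (m - 1)
        ≤ ∑ y, (w x * w y / ∑ z, w z) * w y / (m - 1) := by
          refine Finset.sum_le_sum fun y _ => ?_
          exact div_le_div_of_nonneg_right
            (mul_le_mul_of_nonneg_right (pGRG_le w hw x y) (hw y).le) hm1.le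
      _ = w x / (m - 1) * ((∑ y, w y ^ 2) / ∑ y, w y) := by
          rw [Finset.sum_div, Finset.mul_sum]
          refine Finset.sum_congr rfl fun y _ => ?_
          field_simp
      _ ≤ 32 * u * (C * L ^ δ) := by
          refine mul_le_mul ?_ hA3 h2 (by positivity)
          rw [div_le_iff₀ hm1]
          nlinarith
  have hpow : (0 : ℝ) < (N : ℝ) ^ (-ν) := Real.rpow_pos_of_pos hN0 _
  have hbk : ∀ ω : EdgeIdx N → Bool, ¬
          ((({y | Adj ω x y ∧ precA (Adj ω) x y} \ S1cycA (Adj ω) r x).ncard : ℝ)) ≤ T →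
      k ≤ ({y | Adj ω x y ∧ precA (Adj ω) x y} \ S1cycA (Adj ω) r x).ncard := by
    intro ω h
    rw [not_le] at h
    rw [hk, Nat.succ_le_iff]
    exact (Nat.floor_lt hTp.le).2 h
  by_cases hcase : w x ≤ 16 * (ν * L)
  · -- small weight
    have hle : w x ≤ 16 * u * k := by
      have h1 : u * T = c * (ν * L) / (1 - δ) := by
        rw [hTdef]; field_simp
      have h2 : ν * L ≤ u * T := by
        rw [h1, le_div_iff₀ hd]
        have h0 : 0 < ν * L := by positivity
        nlinarith
      nlinarith [mul_le_mul_of_nonneg_left hTk.le hup.le]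
    have h2 := hbad k (by linarith) hle
    refine (measureReal_mono ?_ (measure_ne_top _ _)).trans (h2.trans (by linarith))
    intro ω hω
    have h3 := hbk ω hω
    refine ⟨h3, ?_⟩
    have h5 : ({y | Adj ω x y ∧ precA (Adj ω) x y} \ S1cycA (Adj ω) r x).ncard ≤
        degA (Adj ω) x :=
      Set.ncard_le_ncard (fun y hy => hy.1.1) (Set.toFinite _)
    exact_mod_cast h3.trans h5
  · -- large weight
    rw [not_le] at hcase
    have hlow : (grgMeasure w).real {ω | (degA (Adj ω) x : ℝ) ≤ w x / 16} ≤ (N : ℝ) ^ (-ν) := by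
      have hS : (N : ℝ) ^ (1 - ε) ≤ ∑ z, w z := by
        unfold m1 at hA2
        rw [le_div_iff₀ hN0] at hA2
        refine le_trans (le_of_eq ?_) hA2
        rw [sub_eq_neg_add, Real.rpow_add hN0, Real.rpow_one]
      have hww : ∀ y, w x * w y ≤ ∑ z, w z := by
        intro y
        calc w x * w y ≤ (N : ℝ) ^ ((1 : ℝ) / 2 - ε) * (N : ℝ) ^ ((1 : ℝ) / 2 - ε) :=
              mul_le_mul (hA1 x) (hA1 y) (hw y).le (Real.rpow_nonneg hN0.le _)
          _ = (N : ℝ) ^ (1 - 2 * ε) := by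
              rw [← Real.rpow_add hN0]; congr 1; ring
          _ ≤ (N : ℝ) ^ (1 - ε) :=
              Real.rpow_le_rpow_of_exponent_le (by linarith) (by linarith)
          _ ≤ _ := hS
      have hwx : 2 * w x ≤ ∑ z, w z := by
        have h2 : (2 : ℝ) ≤ (N : ℝ) ^ ((1 : ℝ) / 2) := by
          rw [← Real.sqrt_eq_rpow]
          exact Real.le_sqrt_of_sq_le (by linarith)
        calc 2 * w x ≤ (N : ℝ) ^ ((1 : ℝ) / 2) * (N : ℝ) ^ ((1 : ℝ) / 2 - ε) :=
              mul_le_mul h2 (hA1 x) (hw x).le (Real.rpow_nonneg hN0.le _)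
          _ = (N : ℝ) ^ (1 - ε) := by
              rw [← Real.rpow_add hN0]; congr 1; ring
          _ ≤ _ := hS
      have hdlow : w x / 4 ≤ ∑ y ∈ Finset.univ.erase x, pGRG w x y := by
        have h1 : ∑ y ∈ Finset.univ.erase x, w x * w y / (2 * ∑ z, w z) ≤
            ∑ y ∈ Finset.univ.erase x, pGRG w x y := by
          refine Finset.sum_le_sum fun y _ => ?_
          unfold pGRG
          have h0 := mul_pos (hw x) (hw y)
          apply div_le_div_of_nonneg_left h0.le (by positivity)
          linarith [hww y]
        refine le_trans ?_ h1
        rw [← Finset.sum_div, ← Finset.mul_sum, le_div_iff₀ (by positivity)]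
        have h3 := Finset.add_sum_erase Finset.univ w (Finset.mem_univ x)
        have h5 : (∑ z, w z) / 2 ≤ ∑ y ∈ Finset.univ.erase x, w y := by linarith
        refine le_trans (le_of_eq ?_) (mul_le_mul_of_nonneg_left h5 (hw x).le)
        ring
      refine (grg_lower w hw x _ _ hdlow).trans ?_
      rw [hNν]
      apply Real.exp_le_exp.2
      linarith
    have h2 := hbad (w x / 16) (by linarith) (by nlinarith [hw x])
    have h3 : {ω : EdgeIdx N → Bool | ¬
          ((({y | Adj ω x y ∧ precA (Adj ω) x y} \ S1cycA (Adj ω) r x).ncard : ℝ)) ≤ T} ⊆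
        {ω | k ≤ ({y | Adj ω x y ∧ precA (Adj ω) x y} \
        S1cycA (Adj ω) r x).ncard ∧ w x / 16 ≤ (degA (Adj ω) x : ℝ)} ∪
        {ω | (degA (Adj ω) x : ℝ) ≤ w x / 16} := by
      intro ω hω
      rcases le_total (w x / 16) (degA (Adj ω) x : ℝ) with h | h
      · exact Or.inl ⟨hbk ω hω, h⟩
      · exact Or.inr h
    refine (measureReal_mono h3 (measure_ne_top _ _)).trans ((measureReal_union_le _ _).trans ?_)
    linarith

end GRG

open GRG in
/-- Few upward neighbours at each vertex.
Under (A1) and (A2), for every vertex `x`, every constant `c > 1` and every `ν > 0`,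
with `ν`-high probability `D_x^{nc+} = #(S_1^+(x) ∖ S_1^cyc(x)) ≤
c (ν/(1−δ)) log N / log log N`. -/
theorem card_upward_neighbours_bounded
    (ε δ : ℝ) (hε : 0 < ε) (hε' : ε < 1 / 2) (hδ : 0 < δ) (hδ' : δ < 1 / 3)
    (r : ℕ) (hr : 6 ≤ r)
    (w : (N : ℕ) → Fin N → ℝ)
    (hpos : ∀ N x, 0 < w N x)
    (hA1 : ∀ N x, w N x ≤ (N : ℝ) ^ ((1 : ℝ) / 2 - ε))
    (hA2m1 : ∀ N : ℕ, 1 ≤ N → (N : ℝ) ^ (-ε) ≤ m1 (w N))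
    (hA2m2 : ∃ C > 0, ∀ N : ℕ, 2 ≤ N → m2 (w N) / m1 (w N) ≤ C * Real.log N ^ δ)
    (ν : ℝ) (hν : 0 < ν) (c : ℝ) (hc : 1 < c) :
    ∃ C > (0 : ℝ), ∀ (N : ℕ) (x : Fin N),
      1 - ENNReal.ofReal (C * (N : ℝ) ^ (-ν)) ≤
        grgMeasure (w N) {ω |
          ((({y | Adj ω x y ∧ precA (Adj ω) x y} \ S1cycA (Adj ω) r x).ncard : ℝ)) ≤
            c * (ν / (1 - δ)) * (Real.log N / Real.log (Real.log N))} := by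
  obtain ⟨C, hC, hm2⟩ := hA2m2
  obtain ⟨N0, hN0⟩ := numeric_event ν δ c C hν hδ' hc hC
  refine ⟨2 + (N0 : ℝ) ^ ν, by positivity, fun N x => ?_⟩
  have hNpos : 0 < N := x.pos
  have hNr : (0 : ℝ) < N := by exact_mod_cast hNpos
  have hprob := grg_prob (w N) (hpos N)
  have hp : (0 : ℝ) < (N : ℝ) ^ (-ν) := Real.rpow_pos_of_pos hNr _
  have h0 : (0 : ℝ) ≤ (N0 : ℝ) ^ ν := by positivity
  rcases le_total N0 N with h | h
  · obtain ⟨a1, a2, a3, a4, a5, a6⟩ := hN0 N h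
    have key := fixed_N (w N) (hpos N) ε δ ν c C hε hδ hδ' hν hc hC r hr (hA1 N)
      (hA2m1 N (by omega)) (hm2 N (by omega)) a1 a2 a3 a4 a5 a6 x
    set S := {ω | ((({y | Adj ω x y ∧ precA (Adj ω) x y} \ S1cycA (Adj ω) r x).ncard : ℝ)) ≤
            c * (ν / (1 - δ)) * (Real.log N / Real.log (Real.log N))} with hS
    have hSm : MeasurableSet S := (Set.toFinite _).measurableSet
    have key2 : (grgMeasure (w N)).real Sᶜ ≤ 2 * (N : ℝ) ^ (-ν) := key
    have h1 : grgMeasure (w N) Sᶜ ≤ ENNReal.ofReal ((2 + (N0 : ℝ) ^ ν) * (N : ℝ) ^ (-ν)) := by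
      rw [← ENNReal.ofReal_toReal (measure_ne_top (grgMeasure (w N)) Sᶜ)]
      apply ENNReal.ofReal_le_ofReal
      exact key2.trans (by nlinarith)
    rw [tsub_le_iff_right]
    calc (1 : ENNReal) = grgMeasure (w N) S + grgMeasure (w N) Sᶜ :=
          (prob_add_prob_compl hSm).symm
      _ ≤ _ := by gcongr
  · have h1 : 1 ≤ (2 + (N0 : ℝ) ^ ν) * (N : ℝ) ^ (-ν) := by
      rw [Real.rpow_neg hNr.le, ← div_eq_mul_inv, le_div_iff₀ (Real.rpow_pos_of_pos hNr _)]
      have : (N : ℝ) ^ ν ≤ (N0 : ℝ) ^ ν :=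
        Real.rpow_le_rpow hNr.le (by exact_mod_cast h) hν.le
      linarith
    have h2 : (1 : ENNReal) ≤ ENNReal.ofReal ((2 + (N0 : ℝ) ^ ν) * (N : ℝ) ^ (-ν)) := by
      rw [← ENNReal.ofReal_one]
      exact ENNReal.ofReal_le_ofReal h1
    rw [tsub_eq_zero_of_le h2]
    exact zero_le
end

section
/- Operator-norm error of the pruning. Under assumptions (A1) and (A2), for every ν > 0 there exists a constant C_ν > 0 such that with ν-high probability ‖A − A^p‖ ≤ C_ν √(log N / log log N), where A and A^p are the adjacency matrices of G and of the pruned graph G^p, and ‖·‖ is the Euclidean operator norm on N×N matrices. -/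
open MeasureTheory Real

namespace GRGAux
open GRG
open scoped Classical

/-! ### Part 1: probability on the finite product space -/

/-- Positive weights give probabilities. -/
lemma pGRG_mem {N : ℕ} {w : Fin N → ℝ} (hw : ∀ x, 0 < w x) (x y : Fin N) :
    0 ≤ pGRG w x y ∧ pGRG w x y ≤ 1 := by
  have h1 : 0 < w x * w y := mul_pos (hw x) (hw y)
  have h2 : 0 ≤ ∑ z, w z := Finset.sum_nonneg fun z _ => (hw z).le
  unfold pGRG
  constructor
  · positivity
  · rw [div_le_one (by positivity)]; linarith

lemma bern_prob {p : ℝ} (h0 : 0 ≤ p) (h1 : p ≤ 1) : IsProbabilityMeasure (bern p) := by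
  constructor
  simp only [bern, Measure.coe_add, Measure.coe_smul, Pi.add_apply, Pi.smul_apply,
    smul_eq_mul, measure_univ, mul_one]
  rw [← ENNReal.ofReal_add h0 (by linarith)]
  simp

lemma bern_integral {p : ℝ} (h0 : 0 ≤ p) (h1 : p ≤ 1) (g : Bool → ℝ) :
    ∫ b, g b ∂(bern p) = p * g true + (1 - p) * g false := by
  unfold bern
  have hd : ∀ c : Bool, Integrable g (Measure.dirac c) := fun c => Integrable.of_finite
  rw [integral_add_measure ((hd _).smul_measure ENNReal.ofReal_ne_top)
      ((hd _).smul_measure ENNReal.ofReal_ne_top),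
    integral_smul_measure, integral_smul_measure, integral_dirac, integral_dirac,
    ENNReal.toReal_ofReal h0, ENNReal.toReal_ofReal (by linarith)]
  simp

lemma grg_prob {N : ℕ} {w : Fin N → ℝ} (hw : ∀ x, 0 < w x) :
    IsProbabilityMeasure (grgMeasure w) := by
  unfold grgMeasure
  have : ∀ e : EdgeIdx N, IsProbabilityMeasure (bern (pGRG w e.val.1 e.val.2)) :=
    fun e => bern_prob (pGRG_mem hw _ _).1 (pGRG_mem hw _ _).2
  infer_instance

/-- edge probability on the index set -/
noncomputable def pe {N : ℕ} (w : Fin N → ℝ) (e : EdgeIdx N) : ℝ := pGRG w e.val.1 e.val.2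

lemma pe_mem {N : ℕ} {w : Fin N → ℝ} (hw : ∀ x, 0 < w x) (e : EdgeIdx N) :
    0 ≤ pe w e ∧ pe w e ≤ 1 := pGRG_mem hw _ _

lemma grg_integral_prod {N : ℕ} {w : Fin N → ℝ} (hw : ∀ x, 0 < w x)
    (g : EdgeIdx N → Bool → ℝ) :
    ∫ ω, ∏ e, g e (ω e) ∂(grgMeasure w) =
      ∏ e, (pe w e * g e true + (1 - pe w e) * g e false) := by
  unfold grgMeasure
  rw [integral_fintype_prod_eq_prod]
  refine Finset.prod_congr rfl fun e _ => ?_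
  exact bern_integral (pGRG_mem hw _ _).1 (pGRG_mem hw _ _).2 _

lemma grg_integrable {N : ℕ} {w : Fin N → ℝ} (hw : ∀ x, 0 < w x)
    (f : (EdgeIdx N → Bool) → ℝ) : Integrable f (grgMeasure w) := by
  have := grg_prob hw
  exact Integrable.of_finite

/-- All edges of `E` are open. -/
def allOpen {N : ℕ} (E : Finset (EdgeIdx N)) (ω : EdgeIdx N → Bool) : Prop :=
  ∀ e ∈ E, ω e = true

lemma integral_allOpen {N : ℕ} {w : Fin N → ℝ} (hw : ∀ x, 0 < w x) (E : Finset (EdgeIdx N)) :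
    ∫ ω, (if allOpen E ω then (1 : ℝ) else 0) ∂(grgMeasure w) = ∏ e ∈ E, pe w e := by
  have h := grg_integral_prod hw (fun e b => if e ∈ E then (if b = true then (1 : ℝ) else 0) else 1)
  have h2 : ∀ ω : EdgeIdx N → Bool, (∏ e, if e ∈ E then (if ω e = true then (1 : ℝ) else 0) else 1)
      = if allOpen E ω then (1 : ℝ) else 0 := by
    intro ω
    rw [Finset.prod_ite_mem, Finset.univ_inter]
    by_cases hA : allOpen E ω
    · rw [if_pos hA]
      exact Finset.prod_eq_one fun e he => by rw [if_pos (hA e he)]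
    · rw [if_neg hA]
      unfold allOpen at hA
      push Not at hA
      obtain ⟨e, he, hne⟩ := hA
      exact Finset.prod_eq_zero he (by rw [if_neg hne])
  simp only [h2] at h
  rw [h]
  rw [← Finset.prod_subset (Finset.subset_univ E)]
  · refine Finset.prod_congr rfl fun e he => ?_
    simp [he]
  · intro e _ he
    simp [he]

/-- Markov inequality. -/
lemma markov {N : ℕ} {w : Fin N → ℝ} (hw : ∀ x, 0 < w x)
    (f : (EdgeIdx N → Bool) → ℝ) (hf : ∀ ω, 0 ≤ f ω) {t : ℝ} (ht : 0 < t)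
    (S : Set (EdgeIdx N → Bool)) (hS : ∀ ω ∈ S, t ≤ f ω) :
    (grgMeasure w).real S ≤ (∫ ω, f ω ∂(grgMeasure w)) / t := by
  have := grg_prob hw
  rw [le_div_iff₀ ht, mul_comm]
  refine le_trans ?_ (mul_meas_ge_le_integral_of_nonneg (Filter.Eventually.of_forall hf)
    (grg_integrable hw f) t)
  refine mul_le_mul_of_nonneg_left ?_ ht.le
  exact measureReal_mono (fun ω h => hS ω h)

/-- Exponential (Chernoff type) bound for the number of edge-disjoint open patterns. -/
lemma chernoff_pattern {N : ℕ} {w : Fin N → ℝ} (hw : ∀ x, 0 < w x) {ι : Type}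
    (s : Finset ι) (e : ι → Finset (EdgeIdx N)) (θ : ℝ) (hθ : 0 ≤ θ) (k : ℕ)
    (S : Set (EdgeIdx N → Bool))
    (hS : ∀ ω ∈ S, ∃ K : Finset ι, K ⊆ s ∧ k ≤ K.card ∧
      (K : Set ι).PairwiseDisjoint e ∧ ∀ i ∈ K, allOpen (e i) ω) :
    (grgMeasure w).real S ≤
      Real.exp (θ * ∑ i ∈ s, ∏ a ∈ e i, pe w a) / (1 + θ) ^ k := by
  set F := s.powerset.filter (fun K : Finset ι => (K : Set ι).PairwiseDisjoint e) with hF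
  set Z : (EdgeIdx N → Bool) → ℝ := fun ω =>
    ∑ K ∈ F, θ ^ K.card * (if allOpen (K.biUnion e) ω then (1 : ℝ) else 0) with hZ
  have hnn : ∀ (ω : EdgeIdx N → Bool) (K : Finset ι),
      0 ≤ θ ^ K.card * (if allOpen (K.biUnion e) ω then (1 : ℝ) else 0) := by
    intro ω K
    apply mul_nonneg (by positivity)
    split_ifs <;> norm_num
  have hZnn : ∀ ω, 0 ≤ Z ω := fun ω => Finset.sum_nonneg fun K _ => hnn ω K
  have hZS : ∀ ω ∈ S, (1 + θ) ^ k ≤ Z ω := by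
    intro ω hω
    obtain ⟨K, hKs, hKk, hKd, hKo⟩ := hS ω hω
    have hsub : K.powerset ⊆ F := by
      intro K' hK'
      rw [Finset.mem_powerset] at hK'
      rw [hF, Finset.mem_filter, Finset.mem_powerset]
      exact ⟨hK'.trans hKs, hKd.subset (by exact_mod_cast hK')⟩
    calc (1 + θ) ^ k ≤ (1 + θ) ^ K.card := pow_le_pow_right₀ (by linarith) hKk
      _ = ∑ K' ∈ K.powerset, θ ^ K'.card := by
          rw [add_comm, ← Finset.sum_pow_mul_eq_add_pow]
          simp
      _ = ∑ K' ∈ K.powerset, θ ^ K'.card * (if allOpen (K'.biUnion e) ω then (1 : ℝ) else 0) := by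
          refine Finset.sum_congr rfl fun K' hK' => ?_
          rw [Finset.mem_powerset] at hK'
          rw [if_pos, mul_one]
          intro a ha
          rw [Finset.mem_biUnion] at ha
          obtain ⟨i, hi, hai⟩ := ha
          exact hKo i (hK' hi) a hai
      _ ≤ Z ω := Finset.sum_le_sum_of_subset_of_nonneg hsub fun K' _ _ => hnn ω K'
  refine (markov hw Z hZnn (by positivity) S hZS).trans ?_
  refine div_le_div_of_nonneg_right ?_ (by positivity)
  have hpn : ∀ i, 0 ≤ ∏ a ∈ e i, pe w a := fun i =>
    Finset.prod_nonneg fun a _ => (pe_mem hw a).1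
  calc ∫ ω, Z ω ∂(grgMeasure w)
      = ∑ K ∈ F, θ ^ K.card * ∏ a ∈ K.biUnion e, pe w a := by
        rw [hZ, integral_finsetSum _ (fun K _ => grg_integrable hw _)]
        refine Finset.sum_congr rfl fun K _ => ?_
        rw [integral_const_mul, integral_allOpen hw]
    _ = ∑ K ∈ F, ∏ i ∈ K, (θ * ∏ a ∈ e i, pe w a) := by
        refine Finset.sum_congr rfl fun K hK => ?_
        rw [hF, Finset.mem_filter] at hK
        rw [Finset.prod_biUnion hK.2, Finset.prod_mul_distrib, Finset.prod_const]
    _ ≤ ∑ K ∈ s.powerset, ∏ i ∈ K, (θ * ∏ a ∈ e i, pe w a) :=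
        Finset.sum_le_sum_of_subset_of_nonneg (Finset.filter_subset _ _)
          fun K _ _ => Finset.prod_nonneg fun i _ => mul_nonneg hθ (hpn i)
    _ = ∏ i ∈ s, (1 + θ * ∏ a ∈ e i, pe w a) := by rw [Finset.prod_one_add]
    _ ≤ Real.exp (∑ i ∈ s, θ * ∏ a ∈ e i, pe w a) := by
        rw [Real.exp_sum]
        refine Finset.prod_le_prod (fun i _ => ?_) (fun i _ => ?_)
        · have := mul_nonneg hθ (hpn i); linarith
        · rw [add_comm]; exact Real.add_one_le_exp _
    _ = _ := by rw [Finset.mul_sum]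

/-! ### edges -/

/-- The index of the edge `{x,y}`. -/
def ed {N : ℕ} (x y : Fin N) (h : x ≠ y) : EdgeIdx N :=
  if hlt : x < y then ⟨(x, y), hlt⟩
  else ⟨(y, x), lt_of_le_of_ne (not_lt.mp hlt) (Ne.symm h)⟩

lemma ed_symm {N : ℕ} (x y : Fin N) (h : x ≠ y) : ed x y h = ed y x h.symm := by
  unfold ed
  rcases lt_or_gt_of_ne h with h1 | h1
  · rw [dif_pos h1, dif_neg (not_lt.mpr h1.le)]
  · rw [dif_pos h1, dif_neg (not_lt.mpr h1.le)]

lemma ed_eq_iff {N : ℕ} (x y x' y' : Fin N) (h : x ≠ y) (h' : x' ≠ y') :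
    ed x y h = ed x' y' h' ↔ (x = x' ∧ y = y') ∨ (x = y' ∧ y = x') := by
  unfold ed
  rcases lt_or_gt_of_ne h with h1 | h1 <;> rcases lt_or_gt_of_ne h' with h2 | h2
  · rw [dif_pos h1, dif_pos h2]; simp only [Subtype.mk.injEq, Prod.mk.injEq]
    constructor
    · exact fun h => Or.inl h
    · rintro (h | ⟨rfl, rfl⟩)
      · exact h
      · exact absurd h1 (not_lt.mpr h2.le)
  · rw [dif_pos h1, dif_neg (not_lt.mpr h2.le)]; simp only [Subtype.mk.injEq, Prod.mk.injEq]
    constructor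
    · exact fun h => Or.inr h
    · rintro (⟨rfl, rfl⟩ | h)
      · exact absurd h1 (not_lt.mpr h2.le)
      · exact h
  · rw [dif_pos h2, dif_neg (not_lt.mpr h1.le)]; simp only [Subtype.mk.injEq, Prod.mk.injEq]
    constructor
    · exact fun h => Or.inr ⟨h.2, h.1⟩
    · rintro (⟨rfl, rfl⟩ | h)
      · exact absurd h1 (not_lt.mpr h2.le)
      · exact ⟨h.2, h.1⟩
  · rw [dif_neg (not_lt.mpr h2.le), dif_neg (not_lt.mpr h1.le)]
    simp only [Subtype.mk.injEq, Prod.mk.injEq]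
    constructor
    · exact fun h => Or.inl ⟨h.2, h.1⟩
    · rintro (h | ⟨rfl, rfl⟩)
      · exact ⟨h.2, h.1⟩
      · exact absurd h1 (not_lt.mpr h2.le)

lemma pe_ed {N : ℕ} (w : Fin N → ℝ) (x y : Fin N) (h : x ≠ y) :
    pe w (ed x y h) = pGRG w x y := by
  unfold ed pe
  split_ifs with h1
  · rfl
  · simp only [pGRG]; rw [mul_comm (w y)]

lemma adj_iff {N : ℕ} (ω : EdgeIdx N → Bool) (x y : Fin N) (h : x ≠ y) :
    Adj ω x y ↔ ω (ed x y h) = true := by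
  unfold Adj adjMatrix ed
  rcases lt_or_gt_of_ne h with h1 | h1
  · rw [dif_pos h1, dif_pos h1]; split_ifs with h2 <;> simp [h2]
  · rw [dif_neg (not_lt.mpr h1.le), dif_neg (not_lt.mpr h1.le), dif_pos h1]
    split_ifs with h2 <;> simp [h2]

lemma adj_ne {N : ℕ} {ω : EdgeIdx N → Bool} {x y : Fin N} (h : Adj ω x y) : x ≠ y := by
  rintro rfl
  simp [Adj, adjMatrix] at h

lemma adj_symm {N : ℕ} {ω : EdgeIdx N → Bool} {x y : Fin N} (h : Adj ω x y) : Adj ω y x := by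
  have hne := adj_ne h
  rw [adj_iff ω y x hne.symm, ← ed_symm]
  exact (adj_iff ω x y hne).1 h

lemma adjMatrix_eq {N : ℕ} (ω : EdgeIdx N → Bool) (x y : Fin N) :
    adjMatrix ω x y = if Adj ω x y then 1 else 0 := by
  unfold Adj adjMatrix
  split_ifs <;> simp_all

/-- `p ≤ w w / W`. -/
lemma pGRG_le {N : ℕ} {w : Fin N → ℝ} (hw : ∀ x, 0 < w x) (x y : Fin N) :
    pGRG w x y ≤ w x * w y / ∑ z, w z := by
  have hW : 0 < ∑ z, w z := Finset.sum_pos (fun z _ => hw z) ⟨x, Finset.mem_univ _⟩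
  have h1 : 0 < w x * w y := mul_pos (hw x) (hw y)
  unfold pGRG
  exact div_le_div_of_nonneg_left h1.le hW (by linarith)

end GRGAux

namespace GRGAux
open GRG
open scoped Classical

/-! ### Part 2: the non-backtracking bound on the operator norm -/

/-- 0-1 matrix of a relation -/
noncomputable def relMat {N : ℕ} (R : Fin N → Fin N → Prop) : Matrix (Fin N) (Fin N) ℝ :=
  fun x y => if R x y then 1 else 0

lemma opNorm_le_of_schur {N : ℕ} (R : Fin N → Fin N → Prop) (hsym : ∀ x y, R x y → R y x)
    (c : Fin N → Fin N → ℝ) (hc : ∀ x y, R x y → 0 < c x y)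
    (hcc : ∀ x y, R x y → c x y * c y x = 1) (K : ℝ) (hK : 0 ≤ K)
    (hrow : ∀ x, ∑ y ∈ Finset.univ.filter (fun y => R x y), c x y ≤ K) :
    opNorm (relMat R) ≤ K := by
  unfold opNorm
  refine ContinuousLinearMap.opNorm_le_bound _ hK fun φ => ?_
  have hsq : ‖(Matrix.toEuclideanCLM (𝕜 := ℝ) (relMat R)) φ‖ ^ 2 ≤ (K * ‖φ‖) ^ 2 := by
    rw [EuclideanSpace.norm_sq_eq, mul_pow, EuclideanSpace.norm_sq_eq]
    have hrowv : ∀ x, ((Matrix.toEuclideanCLM (𝕜 := ℝ) (relMat R)) φ) x =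
        ∑ y ∈ Finset.univ.filter (fun y => R x y), φ y := by
      intro x
      rw [Finset.sum_filter]
      rw [Matrix.ofLp_toEuclideanCLM]
      simp [Matrix.mulVec, dotProduct, relMat]
    have hstep : ∀ x, ‖((Matrix.toEuclideanCLM (𝕜 := ℝ) (relMat R)) φ) x‖ ^ 2 ≤
        K * ∑ y ∈ Finset.univ.filter (fun y => R x y), c y x * φ y ^ 2 := by
      intro x
      rw [hrowv, Real.norm_eq_abs, sq_abs]
      have hcs := Finset.sum_sq_le_sum_mul_sum_of_sq_le_mul
        (Finset.univ.filter (fun y => R x y)) (r := fun y => φ y) (f := fun y => c x y)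
        (g := fun y => c y x * φ y ^ 2)
        (fun y hy => (hc x y (Finset.mem_filter.1 hy).2).le)
        (fun y hy => mul_nonneg (hc y x (hsym _ _ (Finset.mem_filter.1 hy).2)).le (sq_nonneg _))
        (fun y hy => by
          show φ y ^ 2 ≤ c x y * (c y x * φ y ^ 2)
          rw [← mul_assoc, hcc x y (Finset.mem_filter.1 hy).2, one_mul])
      refine hcs.trans (mul_le_mul_of_nonneg_right (hrow x) ?_)
      exact Finset.sum_nonneg fun y hy =>
        mul_nonneg (hc y x (hsym _ _ (Finset.mem_filter.1 hy).2)).le (sq_nonneg _)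
    refine (Finset.sum_le_sum fun x _ => hstep x).trans ?_
    rw [← Finset.mul_sum, sq K, mul_assoc]
    refine mul_le_mul_of_nonneg_left ?_ hK
    simp only [Finset.sum_filter]
    rw [Finset.sum_comm, Finset.mul_sum]
    refine Finset.sum_le_sum fun y _ => ?_
    rw [Real.norm_eq_abs, sq_abs]
    refine le_trans (le_of_eq ?_) (mul_le_mul_of_nonneg_right (hrow y) (sq_nonneg _))
    rw [Finset.sum_filter, Finset.sum_mul]
    refine Finset.sum_congr rfl fun x _ => ?_
    by_cases h : R x y
    · rw [if_pos h, if_pos (hsym _ _ h)]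
    · rw [if_neg h, if_neg (fun h' => h (hsym _ _ h')), zero_mul]
  exact (sq_le_sq₀ (norm_nonneg _) (by positivity)).1 hsq

lemma opNorm_le_of_nb {N : ℕ} (R : Fin N → Fin N → Prop) (hsym : ∀ x y, R x y → R y x)
    (f : Fin N → Fin N → ℝ) (hf : ∀ x y, 0 < f x y) (lam : ℝ) (hlam : 1 ≤ lam)
    (hB : ∀ u v, R u v → ∑ x ∈ Finset.univ.filter (fun x => R v x ∧ x ≠ u), f v x ≤ lam * f u v)
    (D : ℝ) (hD : ∀ x, ((Finset.univ.filter (fun y => R x y)).card : ℝ) ≤ D) (hD0 : 0 ≤ D) :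
    opNorm (relMat R) ≤ lam + D / lam := by
  have hl0 : 0 < lam := by linarith
  have hden : ∀ u v, 0 < f u v + lam * f v u := fun u v =>
    add_pos (hf u v) (mul_pos hl0 (hf v u))
  refine opNorm_le_of_schur R hsym (fun u v => (f v u + lam * f u v) / (f u v + lam * f v u))
    (fun u v _ => div_pos (hden v u) (hden u v)) (fun u v _ => ?_) _ (by positivity) (fun u => ?_)
  · have h1 := hden u v
    have h2 := hden v u
    rw [div_mul_div_comm, mul_comm, div_self (mul_pos h1 h2).ne']
  · set S := ∑ v ∈ Finset.univ.filter (fun v => R u v), f u v with hS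
    have hSle : ∀ v, R u v → S ≤ f u v + lam * f v u := by
      intro v huv
      have h1 := hB v u (hsym _ _ huv)
      have h2 : S = f u v + ∑ x ∈ Finset.univ.filter (fun x => R u x ∧ x ≠ v), f u x := by
        rw [hS, ← Finset.add_sum_erase _ _
          (Finset.mem_filter.2 ⟨Finset.mem_univ v, huv⟩)]
        congr 1
        refine Finset.sum_congr ?_ fun _ _ => rfl
        ext x
        simp [and_comm]
      linarith
    by_cases hne : (Finset.univ.filter (fun v => R u v)).Nonempty
    · have hSpos : 0 < S := Finset.sum_pos (fun v _ => hf u v) hne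
      calc ∑ v ∈ Finset.univ.filter (fun v => R u v),
            (f v u + lam * f u v) / (f u v + lam * f v u)
          ≤ ∑ v ∈ Finset.univ.filter (fun v => R u v), (1 / lam + lam / S * f u v) := by
            refine Finset.sum_le_sum fun v hv => ?_
            have hv' := hSle v (Finset.mem_filter.1 hv).2
            have hd := hden u v
            have ha := hf u v
            have hb := hf v u
            have e1 : (f v u + lam * f u v) / (f u v + lam * f v u) =
                1 / lam + (lam - 1 / lam) * (f u v / (f u v + lam * f v u)) := by
              field_simp
              ring
            rw [e1]
            have h1 : f u v / (f u v + lam * f v u) ≤ f u v / S :=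
              div_le_div_of_nonneg_left ha.le hSpos hv'
            have h2 : lam - 1 / lam ≤ lam := by
              have : 0 < 1 / lam := by positivity
              linarith
            have h3 : 0 ≤ f u v / (f u v + lam * f v u) := by positivity
            have h4 : (lam - 1 / lam) * (f u v / (f u v + lam * f v u)) ≤ lam * (f u v / S) :=
              mul_le_mul h2 h1 h3 hl0.le
            have h5 : lam * (f u v / S) = lam / S * f u v := by ring
            linarith
        _ = (Finset.univ.filter (fun v => R u v)).card / lam + lam := by
            rw [Finset.sum_add_distrib, ← Finset.mul_sum, ← hS, Finset.sum_const, nsmul_eq_mul]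
            field_simp
        _ ≤ lam + D / lam := by
            have := div_le_div_of_nonneg_right (hD u) hl0.le
            linarith
    · rw [Finset.not_nonempty_iff_eq_empty] at hne
      rw [hne]
      simp only [Finset.sum_empty]
      positivity

/-- Number of non-backtracking walks continuing the directed edge `u → v` by `n` steps. -/
noncomputable def nb {N : ℕ} (A : Fin N → Fin N → Prop) : ℕ → Fin N → Fin N → ℝ
  | 0, _, _ => 1
  | n + 1, u, v => ∑ x ∈ Finset.univ.filter (fun x => A v x ∧ x ≠ u), nb A n v x

lemma nb_nonneg {N : ℕ} (A : Fin N → Fin N → Prop) (n : ℕ) (u v : Fin N) : 0 ≤ nb A n u v := by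
  induction n generalizing u v with
  | zero => simp [nb]
  | succ n ih => rw [nb]; exact Finset.sum_nonneg fun x _ => ih _ _

lemma opNorm_le_of_nb_count {N : ℕ} (A R : Fin N → Fin N → Prop)
    (hsym : ∀ x y, R x y → R y x) (hRA : ∀ x y, R x y → A x y)
    (l : ℕ) (hl : 1 ≤ l) (lam : ℝ) (hlam : 1 ≤ lam)
    (hnb : ∀ u v, A u v → nb A l u v ≤ lam ^ l)
    (D : ℝ) (hD : ∀ x, ((Finset.univ.filter (fun y => R x y)).card : ℝ) ≤ D) (hD0 : 0 ≤ D) :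
    opNorm (relMat R) ≤ lam + D / lam := by
  have hl0 : 0 < lam := by linarith
  set f : Fin N → Fin N → ℝ := fun u v => ∑ k ∈ Finset.range l, nb A k u v / lam ^ k with hf
  have hterm : ∀ k u v, 0 ≤ nb A k u v / lam ^ k := fun k u v =>
    div_nonneg (nb_nonneg A k u v) (by positivity)
  refine opNorm_le_of_nb R hsym f ?_ lam hlam ?_ D hD hD0
  · intro u v
    refine Finset.sum_pos' (fun k _ => hterm k u v) ⟨0, Finset.mem_range.2 hl, ?_⟩
    simp [nb]
  · intro u v huv
    have hfnn : ∀ x y, 0 ≤ f x y := fun x y => Finset.sum_nonneg fun k _ => hterm k x y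
    calc ∑ x ∈ Finset.univ.filter (fun x => R v x ∧ x ≠ u), f v x
        ≤ ∑ x ∈ Finset.univ.filter (fun x => A v x ∧ x ≠ u), f v x := by
          refine Finset.sum_le_sum_of_subset_of_nonneg ?_ (fun x _ _ => hfnn v x)
          intro x hx
          rw [Finset.mem_filter] at hx ⊢
          exact ⟨hx.1, hRA _ _ hx.2.1, hx.2.2⟩
      _ = ∑ k ∈ Finset.range l, nb A (k + 1) u v / lam ^ k := by
          rw [hf, Finset.sum_comm]
          refine Finset.sum_congr rfl fun k _ => ?_
          rw [nb, Finset.sum_div]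
      _ = lam * ∑ k ∈ Finset.range l, nb A (k + 1) u v / lam ^ (k + 1) := by
          rw [Finset.mul_sum]
          refine Finset.sum_congr rfl fun k _ => ?_
          rw [pow_succ]
          field_simp
      _ ≤ lam * f u v := by
          refine mul_le_mul_of_nonneg_left ?_ hl0.le
          have h1 := Finset.sum_range_succ (fun k => nb A k u v / lam ^ k) l
          have h2 := Finset.sum_range_succ' (fun k => nb A k u v / lam ^ k) l
          have h3 : nb A 0 u v / lam ^ 0 = 1 := by simp [nb]
          have h4 : nb A l u v / lam ^ l ≤ 1 := by
            rw [div_le_one (by positivity)]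
            exact hnb u v (hRA _ _ huv)
          simp only [hf]
          linarith

end GRGAux

namespace GRGAux
open GRG
open scoped Classical

/-! ### Part 3: non-backtracking walks, weighted counting -/

/-- `{x,y}` is an edge of the walk `h`. -/
def isEdge {N : ℕ} : List (Fin N) → Fin N → Fin N → Prop
  | a :: b :: t, x, y => (x = a ∧ y = b) ∨ (x = b ∧ y = a) ∨ isEdge (b :: t) x y
  | _, _, _ => False

/-- Number of steps of the walk along a new edge to an old vertex (the head is the last vertex). -/
noncomputable def mB {N : ℕ} : List (Fin N) → ℕ
  | v :: u :: t => mB (u :: t) + (if v ∈ u :: t ∧ ¬ isEdge (u :: t) u v then 1 else 0)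
  | _ => 0

/-- Weight of a walk. -/
noncomputable def wt {N : ℕ} (w : Fin N → ℝ) : List (Fin N) → ℝ
  | v :: u :: t => wt w (u :: t) * (if isEdge (u :: t) u v then 1 else w u * w v / ∑ z, w z)
  | _ => 1

/-- Allowed non-backtracking extension. -/
def okExt {N : ℕ} (v : Fin N) : List (Fin N) → Prop
  | [] => False
  | u :: t => v ≠ u ∧ t.head? ≠ some v

/-- Non-backtracking walk. -/
def okList {N : ℕ} : List (Fin N) → Prop
  | v :: u :: t => okExt v (u :: t) ∧ okList (u :: t)
  | _ => True

/-- Weighted number of open non-backtracking extensions. -/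
noncomputable def cnt {N : ℕ} (ω : EdgeIdx N → Bool) (q : ℝ) : ℕ → List (Fin N) → ℝ
  | 0, h => if h.IsChain (Adj ω) then q ^ mB h else 0
  | n + 1, h => ∑ v ∈ Finset.univ.filter (fun v => okExt v h), cnt ω q n (v :: h)

/-- Degree in the walk graph. -/
noncomputable def hd {N : ℕ} (h : List (Fin N)) (x : Fin N) : ℕ :=
  (Finset.univ.filter (fun y => isEdge h x y)).card

lemma isEdge_mem {N : ℕ} (h : List (Fin N)) (x y : Fin N) (hxy : isEdge h x y) :
    x ∈ h ∧ y ∈ h := by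
  induction h with
  | nil => exact hxy.elim
  | cons a t ih =>
    cases t with
    | nil => exact hxy.elim
    | cons b t =>
      rw [isEdge] at hxy
      rcases hxy with ⟨rfl, rfl⟩ | ⟨rfl, rfl⟩ | h
      · simp
      · simp
      · have := ih h
        exact ⟨List.mem_cons_of_mem _ this.1, List.mem_cons_of_mem _ this.2⟩

lemma isEdge_symm {N : ℕ} (h : List (Fin N)) (x y : Fin N) (hxy : isEdge h x y) :
    isEdge h y x := by
  induction h with
  | nil => exact hxy.elim
  | cons a t ih =>
    cases t with
    | nil => exact hxy.elim
    | cons b t =>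
      rw [isEdge] at hxy ⊢
      rcases hxy with ⟨rfl, rfl⟩ | ⟨rfl, rfl⟩ | h
      · exact Or.inr (Or.inl ⟨rfl, rfl⟩)
      · exact Or.inl ⟨rfl, rfl⟩
      · exact Or.inr (Or.inr (ih h))

lemma isEdge_fresh {N : ℕ} (u : Fin N) (t : List (Fin N)) (hu : u ∉ t) (y : Fin N)
    (h : isEdge (u :: t) u y) : t.head? = some y := by
  cases t with
  | nil => exact h.elim
  | cons b t =>
    rw [isEdge] at h
    rcases h with ⟨_, rfl⟩ | ⟨rfl, _⟩ | h
    · rfl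
    · simp at hu
    · exact absurd (isEdge_mem _ _ _ h).1 hu

lemma hd_fresh {N : ℕ} (u : Fin N) (t : List (Fin N)) (hu : u ∉ t) : hd (u :: t) u ≤ 1 := by
  unfold hd
  rw [Finset.card_le_one]
  intro a ha b hb
  have h1 := isEdge_fresh u t hu a (Finset.mem_filter.1 ha).2
  have h2 := isEdge_fresh u t hu b (Finset.mem_filter.1 hb).2
  rw [h1] at h2
  exact Option.some.inj h2

lemma hd_notMem {N : ℕ} (v : Fin N) (h : List (Fin N)) (hv : v ∉ h) : hd h v = 0 := by
  unfold hd
  rw [Finset.card_eq_zero, Finset.filter_eq_empty_iff]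
  intro y _ hy
  exact hv (isEdge_mem _ _ _ hy).1

/-- adding a step increases the degree by at most one, and only at the two endpoints -/
lemma hd_cons {N : ℕ} (v u : Fin N) (t : List (Fin N)) (hvu : v ≠ u) (x : Fin N) :
    hd (v :: u :: t) x ≤ hd (u :: t) x + (if x = v ∨ x = u then 1 else 0) := by
  unfold hd
  have key : Finset.univ.filter (fun y => isEdge (v :: u :: t) x y) ⊆
      Finset.univ.filter (fun y => isEdge (u :: t) x y) ∪
        (if x = v then {u} else if x = u then {v} else ∅) := by
    intro y hy
    rw [Finset.mem_filter] at hy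
    have h := hy.2
    rw [isEdge] at h
    rw [Finset.mem_union]
    rcases h with ⟨rfl, rfl⟩ | ⟨rfl, rfl⟩ | h
    · right; simp
    · right; rw [if_neg hvu.symm]; simp
    · left; simpa using h
  refine (Finset.card_le_card key).trans ((Finset.card_union_le _ _).trans ?_)
  gcongr
  by_cases h1 : x = v
  · simp [h1]
  · by_cases h2 : x = u
    · subst h2
      rw [if_neg h1, if_pos rfl]; simp
    · simp [h1, h2]

lemma hd_cons_old {N : ℕ} (v u : Fin N) (t : List (Fin N)) (he : isEdge (u :: t) u v) (x : Fin N) :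
    hd (v :: u :: t) x = hd (u :: t) x := by
  unfold hd
  congr 1
  ext y
  simp only [Finset.mem_filter, Finset.mem_univ, true_and]
  rw [isEdge]
  constructor
  · rintro (⟨rfl, rfl⟩ | ⟨rfl, rfl⟩ | h)
    · exact isEdge_symm _ _ _ he
    · exact he
    · exact h
  · exact fun h => Or.inr (Or.inr h)

/-- Invariant of non-backtracking walks. -/
def InvL {N : ℕ} : List (Fin N) → Prop
  | [] => False
  | u :: t => (u ∉ t ∧ ∀ x, hd (u :: t) x ≤ 2 * mB (u :: t) + 2) ∨
      (u ∈ t ∧ ∀ x, hd (u :: t) x ≤ 2 * mB (u :: t) + 1)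

lemma InvL_single {N : ℕ} (u : Fin N) : InvL [u] := by
  left
  refine ⟨by simp, fun x => ?_⟩
  have : hd [u] x = 0 := by
    unfold hd
    rw [Finset.card_eq_zero, Finset.filter_eq_empty_iff]
    intro y _ h
    exact h.elim
  omega

lemma InvL_cons {N : ℕ} (v u : Fin N) (t : List (Fin N)) (hI : InvL (u :: t))
    (hok : okExt v (u :: t)) : InvL (v :: u :: t) := by
  have hvu : v ≠ u := hok.1
  have hc := hd_cons v u t hvu
  by_cases hv : v ∈ u :: t
  · right
    refine ⟨hv, fun x => ?_⟩
    by_cases he : isEdge (u :: t) u v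
    · rw [hd_cons_old v u t he]
      rcases hI with ⟨hu, _⟩ | ⟨_, h⟩
      · exact absurd (isEdge_fresh u t hu v he) hok.2
      · have : mB (v :: u :: t) = mB (u :: t) := by
          rw [mB, if_neg (by tauto)]; rfl
        rw [this]; exact h x
    · have hm : mB (v :: u :: t) = mB (u :: t) + 1 := by
        rw [mB, if_pos ⟨hv, he⟩]
      rw [hm]
      have h1 := hc x
      rcases hI with ⟨hu, h⟩ | ⟨_, h⟩ <;> have h2 := h x <;> split_ifs at h1 <;> omega
  · left
    refine ⟨hv, fun x => ?_⟩
    have hm : mB (v :: u :: t) = mB (u :: t) := by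
      rw [mB, if_neg (by tauto)]; rfl
    rw [hm]
    have h1 := hc x
    by_cases hxv : x = v
    · subst hxv
      rw [hd_notMem _ _ hv] at h1
      split_ifs at h1 <;> omega
    · by_cases hxu : x = u
      · subst hxu
        rcases hI with ⟨hu, h⟩ | ⟨_, h⟩
        · have := hd_fresh x t hu
          split_ifs at h1 <;> omega
        · have h2 := h x
          split_ifs at h1 <;> omega
      · rw [if_neg (by tauto)] at h1
        rcases hI with ⟨hu, h⟩ | ⟨_, h⟩ <;> have h2 := h x <;> omega

/-- edge set of a walk -/
noncomputable def eset {N : ℕ} : List (Fin N) → Finset (EdgeIdx N)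
  | v :: u :: t => if h : u ≠ v then insert (ed u v h) (eset (u :: t)) else eset (u :: t)
  | _ => ∅

lemma mem_eset {N : ℕ} (h : List (Fin N)) (x y : Fin N) (hxy : x ≠ y) (hm : ed x y hxy ∈ eset h) :
    isEdge h x y := by
  induction h with
  | nil => simp [eset] at hm
  | cons v t ih =>
    cases t with
    | nil => simp [eset] at hm
    | cons u t =>
      rw [eset] at hm
      rw [isEdge]
      by_cases huv : u ≠ v
      · rw [dif_pos huv, Finset.mem_insert, ed_eq_iff] at hm
        rcases hm with (⟨h1, h2⟩ | ⟨h1, h2⟩) | hm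
        · exact Or.inr (Or.inl ⟨h1, h2⟩)
        · exact Or.inl ⟨h1, h2⟩
        · exact Or.inr (Or.inr (ih hm))
      · rw [dif_neg huv] at hm
        exact Or.inr (Or.inr (ih hm))

lemma chain_allOpen {N : ℕ} (ω : EdgeIdx N → Bool) (h : List (Fin N)) (hc : h.IsChain (Adj ω)) :
    allOpen (eset h) ω := by
  induction h with
  | nil => intro e he; simp [eset] at he
  | cons v t ih =>
    cases t with
    | nil => intro e he; simp [eset] at he
    | cons u t =>
      rw [List.isChain_cons_cons] at hc
      intro e he
      rw [eset] at he
      by_cases huv : u ≠ v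
      · rw [dif_pos huv, Finset.mem_insert] at he
        rcases he with rfl | he
        · exact (adj_iff ω u v huv).1 (adj_symm hc.1)
        · exact ih hc.2 e he
      · rw [dif_neg huv] at he
        exact ih hc.2 e he

lemma wt_nonneg {N : ℕ} {w : Fin N → ℝ} (hw : ∀ x, 0 < w x) (h : List (Fin N)) : 0 ≤ wt w h := by
  induction h with
  | nil => simp [wt]
  | cons v t ih =>
    cases t with
    | nil => simp [wt]
    | cons u t =>
      rw [wt]
      refine mul_nonneg ih ?_
      split_ifs
      · norm_num
      · exact div_nonneg (mul_nonneg (hw u).le (hw v).le) (Finset.sum_nonneg fun z _ => (hw z).le)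

lemma prod_eset_le {N : ℕ} {w : Fin N → ℝ} (hw : ∀ x, 0 < w x) (h : List (Fin N))
    (hc : okList h) : ∏ e ∈ eset h, pe w e ≤ wt w h := by
  induction h with
  | nil => simp [eset, wt]
  | cons v t ih =>
    cases t with
    | nil => simp [eset, wt]
    | cons u t =>
      rw [okList] at hc
      have huv : u ≠ v := hc.1.1.symm
      have ih' := ih hc.2
      rw [eset, wt, dif_pos huv]
      have hP : 0 ≤ ∏ e ∈ eset (u :: t), pe w e :=
        Finset.prod_nonneg fun e _ => (pe_mem hw e).1
      by_cases hm : ed u v huv ∈ eset (u :: t)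
      · rw [Finset.insert_eq_of_mem hm, if_pos (mem_eset _ _ _ _ hm), mul_one]
        exact ih'
      · rw [Finset.prod_insert hm, mul_comm]
        refine mul_le_mul ih' ?_ (pe_mem hw _).1 (wt_nonneg hw _)
        split_ifs
        · exact (pe_mem hw _).2
        · rw [pe_ed]; exact pGRG_le hw u v

lemma integral_chain_le {N : ℕ} {w : Fin N → ℝ} (hw : ∀ x, 0 < w x) (h : List (Fin N))
    (hc : okList h) (c : ℝ) (hc0 : 0 ≤ c) :
    ∫ ω, (if h.IsChain (Adj ω) then c else 0) ∂(grgMeasure w) ≤ wt w h * c := by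
  have h1 : ∫ ω, (if h.IsChain (Adj ω) then c else 0) ∂(grgMeasure w) ≤
      ∫ ω, c * (if allOpen (eset h) ω then (1 : ℝ) else 0) ∂(grgMeasure w) := by
    refine integral_mono (grg_integrable hw _) (grg_integrable hw _) fun ω => ?_
    simp only
    by_cases h : h.IsChain (Adj ω)
    · rw [if_pos h, if_pos (chain_allOpen ω _ h), mul_one]
    · rw [if_neg h]
      split_ifs <;> simp [hc0]
  rw [integral_const_mul, integral_allOpen hw] at h1
  refine h1.trans ?_
  rw [mul_comm]
  exact mul_le_mul_of_nonneg_right (prod_eset_le hw h hc) hc0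

lemma cnt_nonneg {N : ℕ} (ω : EdgeIdx N → Bool) {q : ℝ} (hq : 0 ≤ q) (n : ℕ) (h : List (Fin N)) :
    0 ≤ cnt ω q n h := by
  induction n generalizing h with
  | zero => rw [cnt]; split_ifs <;> positivity
  | succ n ih => rw [cnt]; exact Finset.sum_nonneg fun v _ => ih _

/-- Main expectation bound for weighted non-backtracking walks. -/
lemma integral_cnt_le {N : ℕ} {w : Fin N → ℝ} (hw : ∀ x, 0 < w x)
    (q O B κ L : ℝ) (hq : 1 ≤ q) (hO : 1 ≤ O) (hB : ∀ x, w x ≤ B) (hL0 : 0 ≤ L)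
    (hκ : (∑ x, w x ^ 2) / (∑ x, w x) ≤ κ)
    (G : ℕ → ℕ → ℝ) (hG : ∀ n m, 0 ≤ G n m) (hG0 : ∀ m, 1 ≤ G 0 m)
    (hc1 : ∀ n m : ℕ, (n : ℝ) ≤ L → (κ + 1) * G n m + L * (B / ∑ x, w x) * q * O * G n (m + 1) ≤
      G (n + 1) m)
    (hc2 : ∀ n m : ℕ, (n : ℝ) ≤ L →
      (2 * m + 1) * O * G n m + B * (κ + 1) * G n m +
      L * (B * (B / ∑ x, w x)) * q * O * G n (m + 1) ≤ O * G (n + 1) m)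
    (n : ℕ) (u : Fin N) (t : List (Fin N)) (hlen : ((u :: t).length : ℝ) + n ≤ L)
    (hI : InvL (u :: t)) (hok : okList (u :: t)) :
    ∫ ω, cnt ω q n (u :: t) ∂(grgMeasure w) ≤
      wt w (u :: t) * q ^ mB (u :: t) * ((if u ∈ t then O else w u + 1) * G n (mB (u :: t))) := by
  have hW : 0 < ∑ z, w z := Finset.sum_pos (fun z _ => hw z) ⟨u, Finset.mem_univ _⟩
  induction n generalizing u t with
  | zero =>
    simp only [cnt]
    refine (integral_chain_le hw _ hok _ (by positivity)).trans ?_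
    have h1 : 1 ≤ (if u ∈ t then O else w u + 1) := by
      split_ifs
      · exact hO
      · linarith [hw u]
    have h2 : 1 ≤ (if u ∈ t then O else w u + 1) * G 0 (mB (u :: t)) :=
      one_le_mul_of_one_le_of_one_le h1 (hG0 _)
    have h3 : 0 ≤ wt w (u :: t) * q ^ mB (u :: t) := mul_nonneg (wt_nonneg hw _) (by positivity)
    nlinarith
  | succ n ih =>
    simp only [cnt]
    rw [integral_finsetSum _ (fun v _ => grg_integrable hw _)]
    set m := mB (u :: t) with hm
    set W := ∑ z, w z with hWdef
    set X := wt w (u :: t) * q ^ m with hX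
    have hX0 : 0 ≤ X := mul_nonneg (wt_nonneg hw _) (by positivity)
    have hB0 : 0 < B := (hw u).trans_le (hB u)
    have hnL : (n : ℝ) ≤ L := by
      have : (0 : ℝ) ≤ ((u :: t).length : ℝ) := Nat.cast_nonneg _
      push_cast at hlen this
      linarith
    have hterm : ∀ v ∈ Finset.univ.filter (fun v => okExt v (u :: t)),
        ∫ ω, cnt ω q n (v :: u :: t) ∂(grgMeasure w) ≤
          X * (w u * w v / W * (w v + 1) * G n m +
            (if v ∈ u :: t then w u * (B / W) * q * O * G n (m + 1) else 0) +
            (if isEdge (u :: t) u v ∧ u ∈ t then O * G n m else 0)) := by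
      intro v hv
      have hokv : okExt v (u :: t) := (Finset.mem_filter.1 hv).2
      have hlen' : ((v :: u :: t).length : ℝ) + n ≤ L := by
        rw [List.length_cons]
        push_cast at hlen ⊢
        linarith
      have h1 := ih v (u :: t) hlen' (InvL_cons v u t hI hokv) ⟨hokv, hok⟩
      refine h1.trans ?_
      have hn1 : 0 ≤ w u * w v / W * (w v + 1) * G n m := by
        have := (hw u).le; have := (hw v).le; have := hG n m
        positivity
      have hn2 : 0 ≤ w u * (B / W) * q * O * G n (m + 1) := by
        have := (hw u).le; have := hG n (m + 1); have : 0 ≤ q := by linarith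
        have : 0 ≤ O := by linarith
        positivity
      by_cases hmem : v ∈ u :: t
      · rw [if_pos hmem, if_pos hmem]
        by_cases he : isEdge (u :: t) u v
        · have hut : u ∈ t := by
            by_contra hut
            exact hokv.2 (isEdge_fresh u t hut v he)
          have hm' : mB (v :: u :: t) = m := by
            rw [mB, if_neg (by tauto)]; rfl
          rw [hm', wt, if_pos he, mul_one, if_pos ⟨he, hut⟩, ← hX]
          refine mul_le_mul_of_nonneg_left ?_ hX0
          linarith
        · have hm' : mB (v :: u :: t) = m + 1 := by
            rw [mB, if_pos ⟨hmem, he⟩]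
          rw [hm', wt, if_neg he, if_neg (by tauto)]
          have e1 : wt w (u :: t) * (w u * w v / ∑ z, w z) * q ^ (m + 1) * (O * G n (m + 1)) =
              X * (w u * (w v / W) * q * O * G n (m + 1)) := by
            rw [hX, pow_succ, ← hWdef]; ring
          rw [e1]
          refine mul_le_mul_of_nonneg_left ?_ hX0
          have : w u * (w v / W) * q * O * G n (m + 1) ≤ w u * (B / W) * q * O * G n (m + 1) := by
            have h0 := (hw u).le
            have h2 := hG n (m + 1)
            have h3 : 0 ≤ q := by linarith
            have h4 : 0 ≤ O := by linarith
            have h5 := hB v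
            gcongr
          linarith
      · have he : ¬ isEdge (u :: t) u v := fun he => hmem (isEdge_mem _ _ _ he).2
        have hm' : mB (v :: u :: t) = m := by
          rw [mB, if_neg (by tauto)]; rfl
        rw [if_neg hmem, if_neg hmem, hm', wt, if_neg he, if_neg (by tauto)]
        have e1 : wt w (u :: t) * (w u * w v / ∑ z, w z) * q ^ m * ((w v + 1) * G n m) =
            X * (w u * w v / W * (w v + 1) * G n m + 0 + 0) := by
          rw [hX, ← hWdef]; ring
        rw [e1]
    have hnn : ∀ v, 0 ≤ X * (w u * w v / W * (w v + 1) * G n m +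
            (if v ∈ u :: t then w u * (B / W) * q * O * G n (m + 1) else 0) +
            (if isEdge (u :: t) u v ∧ u ∈ t then O * G n m else 0)) := by
      intro v
      refine mul_nonneg hX0 ?_
      have hq0 : 0 ≤ q := by linarith
      have hO0 : 0 ≤ O := by linarith
      have h1 := (hw u).le
      have h2 := (hw v).le
      have h3 := hG n m
      have h4 := hG n (m + 1)
      refine add_nonneg (add_nonneg (by positivity) ?_) ?_
      · split_ifs <;> positivity
      · split_ifs <;> positivity
    refine (Finset.sum_le_sum hterm).trans ?_
    refine (Finset.sum_le_sum_of_subset_of_nonneg (Finset.filter_subset _ _)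
      (fun v _ _ => hnn v)).trans ?_
    rw [← Finset.mul_sum]
    refine mul_le_mul_of_nonneg_left ?_ hX0
    rw [Finset.sum_add_distrib, Finset.sum_add_distrib]
    have s1 : ∑ v, w u * w v / W * (w v + 1) * G n m ≤ w u * ((κ + 1) * G n m) := by
      have : ∑ v, w u * w v / W * (w v + 1) * G n m =
          w u * (((∑ v, w v ^ 2) / W + (∑ v, w v) / W) * G n m) := by
        rw [Finset.sum_div, Finset.sum_div, ← Finset.sum_add_distrib, Finset.sum_mul,
          Finset.mul_sum]
        refine Finset.sum_congr rfl fun v _ => ?_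
        ring
      rw [this, ← hWdef, div_self hW.ne']
      have := (hw u).le
      have := hG n m
      gcongr
    have s2 : ∑ v, (if v ∈ u :: t then w u * (B / W) * q * O * G n (m + 1) else 0) ≤
        w u * (L * (B / W) * q * O * G n (m + 1)) := by
      rw [← Finset.sum_filter, Finset.sum_const, nsmul_eq_mul]
      have hcard : ((Finset.univ.filter (fun v => v ∈ u :: t)).card : ℝ) ≤ L := by
        have h1 : Finset.univ.filter (fun v => v ∈ u :: t) ⊆ (u :: t).toFinset := by
          intro v hv
          rw [List.mem_toFinset]
          exact (Finset.mem_filter.1 hv).2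
        have h2 := (Finset.card_le_card h1).trans (List.toFinset_card_le _)
        have h3 : ((Finset.univ.filter (fun v => v ∈ u :: t)).card : ℝ) ≤ ((u :: t).length : ℝ) := by
          exact_mod_cast h2
        have h4 : (0 : ℝ) ≤ ((n + 1 : ℕ) : ℝ) := Nat.cast_nonneg _
        linarith
      have hq0 : 0 ≤ q := by linarith
      have hO0 : 0 ≤ O := by linarith
      have h1 := (hw u).le
      have h4 := hG n (m + 1)
      have h5 : 0 ≤ w u * (B / W) * q * O * G n (m + 1) := by positivity
      calc _ ≤ L * (w u * (B / W) * q * O * G n (m + 1)) := mul_le_mul_of_nonneg_right hcard h5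
        _ = _ := by ring
    by_cases hut : u ∈ t
    · rw [if_pos hut]
      have s3 : ∑ v, (if isEdge (u :: t) u v ∧ u ∈ t then O * G n m else 0) ≤
          (2 * m + 1) * O * G n m := by
        rw [← Finset.sum_filter, Finset.sum_const, nsmul_eq_mul, mul_assoc]
        refine mul_le_mul_of_nonneg_right ?_ (mul_nonneg (by linarith) (hG n m))
        have h1 : hd (u :: t) u ≤ 2 * m + 1 := by
          rcases hI with ⟨h, _⟩ | ⟨_, h⟩
          · exact absurd hut h
          · exact h u
        have h2 : (Finset.univ.filter (fun v => isEdge (u :: t) u v ∧ u ∈ t)).card ≤ 2 * m + 1 := by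
          refine le_trans (Finset.card_le_card ?_) h1
          intro v hv
          rw [Finset.mem_filter] at hv ⊢
          exact ⟨hv.1, hv.2.1⟩
        exact_mod_cast h2
      have h2 := hc2 n m hnL
      have s1' : w u * ((κ + 1) * G n m) ≤ B * (κ + 1) * G n m := by
        rw [mul_assoc]
        refine mul_le_mul_of_nonneg_right (hB u) (mul_nonneg ?_ (hG n m))
        have : 0 ≤ (∑ x, w x ^ 2) / (∑ x, w x) := div_nonneg (Finset.sum_nonneg fun x _ => sq_nonneg _) hW.le
        linarith
      have s2' : w u * (L * (B / W) * q * O * G n (m + 1)) ≤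
          L * (B * (B / W)) * q * O * G n (m + 1) := by
        have hq0 : 0 ≤ q := by linarith
        have hO0 : 0 ≤ O := by linarith
        have h4 := hG n (m + 1)
        calc _ ≤ B * (L * (B / W) * q * O * G n (m + 1)) :=
              mul_le_mul_of_nonneg_right (hB u) (by positivity)
          _ = _ := by ring
      linarith
    · rw [if_neg hut]
      have s3 : ∑ v, (if isEdge (u :: t) u v ∧ u ∈ t then O * G n m else 0) = 0 := by
        refine Finset.sum_eq_zero fun v _ => ?_
        rw [if_neg (by tauto)]
      rw [s3]
      have h1 := hc1 n m hnL
      have h2 : w u * ((κ + 1) * G n m + L * (B / W) * q * O * G n (m + 1)) ≤ w u * G (n + 1) m :=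
        mul_le_mul_of_nonneg_left h1 (hw u).le
      have := hG (n + 1) m
      nlinarith

lemma nb_le_cnt {N : ℕ} (ω : EdgeIdx N → Bool) {q : ℝ} (hq : 1 ≤ q) (n : ℕ) (u v : Fin N)
    (t : List (Fin N)) (hc : (v :: u :: t).IsChain (Adj ω)) :
    nb (Adj ω) n u v ≤ cnt ω q n (v :: u :: t) := by
  induction n generalizing u v t with
  | zero => rw [nb, cnt, if_pos hc]; exact one_le_pow₀ hq
  | succ n ih =>
    rw [nb, cnt]
    refine le_trans (Finset.sum_le_sum (g := fun x => cnt ω q n (x :: v :: u :: t)) ?_)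
      (Finset.sum_le_sum_of_subset_of_nonneg ?_ (fun x _ _ => cnt_nonneg ω (by linarith) _ _))
    · intro x hx
      rw [Finset.mem_filter] at hx
      exact ih v x (u :: t) (List.isChain_cons_cons.2 ⟨adj_symm hx.2.1, hc⟩)
    · intro x hx
      rw [Finset.mem_filter] at hx ⊢
      refine ⟨hx.1, (adj_ne hx.2.1).symm, ?_⟩
      intro h
      exact hx.2.2 (Option.some.inj h).symm

lemma nb_le_cnt_single {N : ℕ} (ω : EdgeIdx N → Bool) {q : ℝ} (hq : 1 ≤ q) (n : ℕ) (u v : Fin N)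
    (h : Adj ω u v) : nb (Adj ω) n u v ≤ cnt ω q (n + 1) [u] := by
  refine (nb_le_cnt ω hq n u v [] ?_).trans ?_
  · exact List.isChain_cons_cons.2 ⟨adj_symm h, List.isChain_singleton _⟩
  · rw [cnt]
    refine Finset.single_le_sum (f := fun v => cnt ω q n (v :: [u]))
      (fun x _ => cnt_nonneg ω (by linarith) _ _) ?_
    rw [Finset.mem_filter]
    exact ⟨Finset.mem_univ _, (adj_ne h).symm, by simp⟩

lemma okList_of_append {N : ℕ} (t h : List (Fin N)) (hok : okList (t ++ h)) : okList h := by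
  induction t with
  | nil => exact hok
  | cons a t ih =>
    apply ih
    cases hth : t ++ h with
    | nil => trivial
    | cons b s =>
      rw [List.cons_append, hth] at hok
      exact hok.2

lemma cnt_ge_of_walk {N : ℕ} (ω : EdgeIdx N → Bool) {q : ℝ} (hq : 0 ≤ q) (t : List (Fin N))
    (u : Fin N) (s : List (Fin N))
    (hok : okList (t ++ u :: s)) (hc : (t ++ u :: s).IsChain (Adj ω)) :
    q ^ mB (t ++ u :: s) ≤ cnt ω q t.length (u :: s) := by
  induction t using List.reverseRecOn generalizing u s with
  | nil => simp [cnt, hc] at *; rw [if_pos hc]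
  | append_singleton t v ih =>
    have e : t ++ [v] ++ u :: s = t ++ v :: (u :: s) := by simp
    rw [e] at hok hc ⊢
    refine (ih v (u :: s) hok hc).trans ?_
    rw [List.length_append, List.length_singleton, cnt]
    refine Finset.single_le_sum (f := fun v => cnt ω q t.length (v :: u :: s))
      (fun x _ => cnt_nonneg ω hq _ _) ?_
    rw [Finset.mem_filter]
    exact ⟨Finset.mem_univ _, (okList_of_append _ _ hok).1⟩

end GRGAux

namespace GRGAux
open GRG
open scoped Classical

/-! ### Part 4: expected weighted number of walks from a vertex -/

lemma shift_pow_le {Λ L : ℝ} (hΛ : 1 ≤ Λ) (n m : ℕ) (hn : (n : ℝ) ≤ L) :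
    (Λ + 8 * ((m + 1 : ℕ) : ℝ)) ^ n ≤ (Λ + 8 * (m : ℝ)) ^ n * exp (8 * L / Λ) := by
  have hm : (0 : ℝ) ≤ m := Nat.cast_nonneg m
  have h0 : 0 < Λ + 8 * (m : ℝ) := by positivity
  have h1 : Λ + 8 * ((m + 1 : ℕ) : ℝ) ≤ (Λ + 8 * (m : ℝ)) * exp (8 / Λ) := by
    have h2 : 8 / Λ + 1 ≤ exp (8 / Λ) := add_one_le_exp _
    have h3 : (Λ + 8 * (m : ℝ)) * (8 / Λ + 1) ≤ (Λ + 8 * (m : ℝ)) * exp (8 / Λ) := by gcongr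
    refine le_trans ?_ h3
    have h4 : Λ * (8 / Λ) = 8 := by field_simp
    have h5 : 0 ≤ 8 * (m : ℝ) * (8 / Λ) := by positivity
    push_cast
    nlinarith
  calc (Λ + 8 * ((m + 1 : ℕ) : ℝ)) ^ n ≤ ((Λ + 8 * (m : ℝ)) * exp (8 / Λ)) ^ n := by
        gcongr
    _ = (Λ + 8 * (m : ℝ)) ^ n * exp (n * (8 / Λ)) := by
        rw [mul_pow, ← exp_nat_mul]
    _ ≤ _ := by
        gcongr
        rw [mul_comm 8 L, mul_div_assoc]
        gcongr

lemma expected_cnt {N : ℕ} {w : Fin N → ℝ} (hw : ∀ x, 0 < w x)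
    (q O B κ L Λ : ℝ) (hq : 1 ≤ q) (hO : 1 ≤ O) (hB : ∀ x, w x ≤ B) (hL0 : 0 ≤ L)
    (hκ : (∑ x, w x ^ 2) / (∑ x, w x) ≤ κ) (hΛ : 4 ≤ Λ) (hκΛ : κ + 1 ≤ Λ / 2)
    (hBO : B * (κ + 1) ≤ O)
    (h1 : L * (B / ∑ x, w x) * q * O * exp (8 * L / Λ) ≤ 1)
    (h2 : L * (B * (B / ∑ x, w x)) * q * exp (8 * L / Λ) ≤ 1)
    (n : ℕ) (u : Fin N) (hn : (n : ℝ) + 1 ≤ L) :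
    ∫ ω, cnt ω q n [u] ∂(grgMeasure w) ≤ (w u + 1) * Λ ^ n := by
  have hW : 0 < ∑ z, w z := Finset.sum_pos (fun z _ => hw z) ⟨u, Finset.mem_univ _⟩
  have hB0 : 0 < B := (hw u).trans_le (hB u)
  have key := integral_cnt_le hw q O B κ L hq hO hB hL0 hκ (fun n m => (Λ + 8 * (m : ℝ)) ^ n)
    (fun n m => by positivity) (fun m => by simp) ?_ ?_ n u [] ?_ (InvL_single u) trivial
  · have e1 : mB [u] = 0 := rfl
    have e2 : wt w [u] = 1 := rfl
    rw [e1, e2] at key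
    simpa using key
  · intro n m hnL
    have hs := shift_pow_le (by linarith : 1 ≤ Λ) n m hnL
    have hm : (0 : ℝ) ≤ m := Nat.cast_nonneg m
    have hP : 0 ≤ (Λ + 8 * (m : ℝ)) ^ n := by positivity
    rw [pow_succ]
    set P := (Λ + 8 * (m : ℝ)) ^ n
    have a1 : (κ + 1) * P ≤ Λ / 2 * P := by gcongr
    have a2 : L * (B / ∑ x, w x) * q * O * (Λ + 8 * ((m + 1 : ℕ) : ℝ)) ^ n ≤ P := by
      calc _ ≤ L * (B / ∑ x, w x) * q * O * (P * exp (8 * L / Λ)) := by gcongr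
        _ = (L * (B / ∑ x, w x) * q * O * exp (8 * L / Λ)) * P := by ring
        _ ≤ 1 * P := by gcongr
        _ = P := one_mul _
    have a3 : 0 ≤ P * (8 * (m : ℝ)) := by positivity
    have a4 : 4 * P ≤ Λ * P := by gcongr
    nlinarith
  · intro n m hnL
    have hs := shift_pow_le (by linarith : 1 ≤ Λ) n m hnL
    have hm : (0 : ℝ) ≤ m := Nat.cast_nonneg m
    have hP : 0 ≤ (Λ + 8 * (m : ℝ)) ^ n := by positivity
    rw [pow_succ]
    set P := (Λ + 8 * (m : ℝ)) ^ n
    have a1 : B * (κ + 1) * P ≤ O * P := by gcongr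
    have a2 : L * (B * (B / ∑ x, w x)) * q * O * (Λ + 8 * ((m + 1 : ℕ) : ℝ)) ^ n ≤ O * P := by
      calc _ ≤ L * (B * (B / ∑ x, w x)) * q * O * (P * exp (8 * L / Λ)) := by gcongr
        _ = (L * (B * (B / ∑ x, w x)) * q * exp (8 * L / Λ)) * (O * P) := by ring
        _ ≤ 1 * (O * P) := by gcongr
        _ = O * P := one_mul _
    have a5 : 0 ≤ O * P := by positivity
    have a3 : 0 ≤ O * P * (m : ℝ) := by positivity
    have a4 : 4 * (O * P) ≤ Λ * (O * P) := by gcongr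
    nlinarith
  · simp; linarith

lemma cnt_event {N : ℕ} {w : Fin N → ℝ} (hw : ∀ x, 0 < w x)
    (q O B κ L Λ : ℝ) (hq : 1 ≤ q) (hO : 1 ≤ O) (hB : ∀ x, w x ≤ B) (hL0 : 0 ≤ L)
    (hκ : (∑ x, w x ^ 2) / (∑ x, w x) ≤ κ) (hΛ : 4 ≤ Λ) (hκΛ : κ + 1 ≤ Λ / 2)
    (hBO : B * (κ + 1) ≤ O)
    (h1 : L * (B / ∑ x, w x) * q * O * exp (8 * L / Λ) ≤ 1)
    (h2 : L * (B * (B / ∑ x, w x)) * q * exp (8 * L / Λ) ≤ 1)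
    (n : ℕ) (hn : (n : ℝ) + 1 ≤ L) (t : ℝ) (ht : 0 < t) :
    (grgMeasure w).real {ω | ∃ u, t ≤ cnt ω q n [u]} ≤ N * ((B + 1) * Λ ^ n / t) := by
  have := grg_prob hw
  have e : {ω : EdgeIdx N → Bool | ∃ u, t ≤ cnt ω q n [u]} =
      ⋃ u ∈ (Finset.univ : Finset (Fin N)), {ω | t ≤ cnt ω q n [u]} := by
    ext; simp
  rw [e]
  refine (measureReal_biUnion_finset_le _ _).trans ?_
  have : ∀ u ∈ (Finset.univ : Finset (Fin N)),
      (grgMeasure w).real {ω | t ≤ cnt ω q n [u]} ≤ (B + 1) * Λ ^ n / t := by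
    intro u _
    refine (markov hw (fun ω => cnt ω q n [u])
      (fun ω => cnt_nonneg ω (by linarith) _ _) ht _ (fun ω h => h)).trans ?_
    gcongr
    refine (expected_cnt hw q O B κ L Λ hq hO hB hL0 hκ hΛ hκΛ hBO h1 h2 n u hn).trans ?_
    gcongr
    exact hB u
  refine (Finset.sum_le_sum this).trans ?_
  simp

end GRGAux

namespace GRGAux
open GRG
open scoped Classical

/-! ### Part 5: many short cycles give walks with many new edges to old vertices -/

/-- Append the vertices of a path to a history. -/
def app {N : ℕ} (γ : ℕ → Fin N) (h : List (Fin N)) : ℕ → List (Fin N)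
  | 0 => h
  | j + 1 => γ (j + 1) :: app γ h j

lemma app_eq {N : ℕ} (γ : ℕ → Fin N) (h : List (Fin N)) (j : ℕ) :
    ∃ s : List (Fin N), s.length = j ∧ app γ h j = s ++ h := by
  induction j with
  | zero => exact ⟨[], rfl, rfl⟩
  | succ j ih =>
    obtain ⟨s, hs, he⟩ := ih
    exact ⟨γ (j + 1) :: s, by simp [hs], by rw [app, he]; rfl⟩

lemma app_head {N : ℕ} (γ : ℕ → Fin N) (t : List (Fin N)) (j : ℕ) :
    ∃ s, app γ (γ 0 :: t) j = γ j :: s := by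
  cases j with
  | zero => exact ⟨t, rfl⟩
  | succ j => exact ⟨_, rfl⟩

lemma isEdge_head {N : ℕ} (x y : Fin N) (t : List (Fin N)) (h : t.head? = some y) :
    isEdge (x :: t) x y := by
  cases t with
  | nil => simp at h
  | cons b t =>
    simp at h
    subst h
    exact Or.inl ⟨rfl, rfl⟩

lemma append_cycle {N : ℕ} (ω : EdgeIdx N → Bool) (γ : ℕ → Fin N) (t : List (Fin N)) (l : ℕ)
    (hl : 3 ≤ l) (hγ : γ l = γ 0) (hp : IsPathOn (Adj ω) l γ) (hs : IsSimplePath l γ)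
    (hok : okList (γ 0 :: t)) (hc : (γ 0 :: t).IsChain (Adj ω))
    (hne : ¬ isEdge (γ 0 :: t) (γ 0) (γ 1)) :
    okList (app γ (γ 0 :: t) l) ∧ (app γ (γ 0 :: t) l).IsChain (Adj ω) ∧
      hd (app γ (γ 0 :: t) l) (γ 0) ≤ hd (γ 0 :: t) (γ 0) + 2 ∧
      mB (γ 0 :: t) + 1 ≤ mB (app γ (γ 0 :: t) l) := by
  set h := γ 0 :: t with hh
  -- non-backtracking
  have hext : ∀ j, j < l → okExt (γ (j + 1)) (app γ h j) := by
    intro j hj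
    have hadj := adj_ne (hp j hj)
    cases j with
    | zero =>
      refine ⟨hadj.symm, fun hcon => hne ?_⟩
      exact isEdge_head _ _ _ hcon
    | succ j =>
      obtain ⟨s, hs'⟩ := app_head γ t j
      rw [app, hs']
      refine ⟨hadj.symm, ?_⟩
      simp only [List.head?_cons, ne_eq, Option.some.injEq]
      exact hs j (j + 1 + 1) (by omega) (by omega) (by omega)
  have hmain : ∀ j, j ≤ l → okList (app γ h j) ∧ (app γ h j).IsChain (Adj ω) := by
    intro j
    induction j with
    | zero => exact fun _ => ⟨hok, hc⟩
    | succ j ih =>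
      intro hj
      obtain ⟨i1, i2⟩ := ih (by omega)
      obtain ⟨s, hs'⟩ := app_head γ t j
      have he := hext j (by omega)
      rw [app]
      rw [← hh] at hs'
      rw [hs'] at i1 i2 he ⊢
      exact ⟨⟨he, i1⟩, List.isChain_cons_cons.2 ⟨adj_symm (hp j (by omega)), i2⟩⟩
  have hstep : ∀ j, j < l → hd (app γ h (j + 1)) (γ 0) ≤ hd (app γ h j) (γ 0) +
      (if γ 0 = γ (j + 1) ∨ γ 0 = γ j then 1 else 0) := by
    intro j hj
    obtain ⟨s, hs'⟩ := app_head γ t j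
    rw [app]
    rw [← hh] at hs'
    rw [hs']
    exact hd_cons _ _ _ (adj_ne (hp j hj)).symm _
  have hhd : ∀ j, j < l → hd (app γ h j) (γ 0) ≤ hd h (γ 0) + 1 := by
    intro j
    induction j with
    | zero => intro _; rw [app]; omega
    | succ j ih =>
      intro hj
      have h1 := hstep j (by omega)
      have h2 := ih (by omega)
      cases j with
      | zero =>
        rw [app] at h1
        split_ifs at h1 <;> omega
      | succ j =>
        rw [if_neg] at h1
        · omega
        · rintro (h3 | h3)
          · exact hs 0 _ (by omega) (by omega) (by omega) h3
          · exact hs 0 _ (by omega) (by omega) (by omega) h3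
  have hmono : ∀ j, mB (app γ h j) ≤ mB (app γ h (j + 1)) := by
    intro j
    obtain ⟨s, hs'⟩ := app_head γ t j
    rw [← hh] at hs'
    rw [app, hs', mB]
    omega
  have hnew : ∀ j, j < l → mB h + 1 ≤ mB (app γ h (j + 1)) ∨ γ (j + 1) ∉ app γ h j := by
    intro j
    induction j with
    | zero =>
      intro _
      by_cases hm : γ (0 + 1) ∈ app γ h 0
      · left
        have e : mB (γ 1 :: γ 0 :: t) = mB (γ 0 :: t) + (if γ 1 ∈ γ 0 :: t ∧
            ¬ isEdge (γ 0 :: t) (γ 0) (γ 1) then 1 else 0) := rfl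
        rw [if_pos ⟨hm, hne⟩] at e
        exact e.ge
      · exact Or.inr hm
    | succ j ih =>
      intro hj
      rcases ih (by omega) with h1 | h1
      · exact Or.inl (h1.trans (hmono _))
      · by_cases hm : γ (j + 1 + 1) ∈ app γ h (j + 1)
        · left
          have hm0 : mB h ≤ mB (app γ h (j + 1)) := by
            have : Monotone (fun i => mB (app γ h i)) := monotone_nat_of_le_succ hmono
            exact this (Nat.zero_le (j + 1))
          have hE : ¬ isEdge (app γ h (j + 1)) (γ (j + 1)) (γ (j + 1 + 1)) := by
            intro hcon
            rw [app] at hcon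
            have := isEdge_fresh _ _ h1 _ hcon
            have he := hext (j + 1) hj
            rw [app] at he
            exact he.2 this
          rw [app] at hm hE hm0 ⊢
          rw [app, mB, if_pos ⟨hm, hE⟩]
          omega
        · exact Or.inr hm
  refine ⟨(hmain l le_rfl).1, (hmain l le_rfl).2, ?_, ?_⟩
  · obtain ⟨l', rfl⟩ : ∃ l', l = l' + 1 := ⟨l - 1, by omega⟩
    have h1 := hstep l' (by omega)
    have h2 := hhd l' (by omega)
    split_ifs at h1 <;> omega
  · obtain ⟨l', rfl⟩ : ∃ l', l = l' + 1 := ⟨l - 1, by omega⟩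
    rcases hnew l' (by omega) with h1 | h1
    · exact h1
    · exfalso
      apply h1
      obtain ⟨s, _, hs'⟩ := app_eq γ h l'
      rw [hs', hγ, hh]
      simp

lemma cyc_iter {N : ℕ} (ω : EdgeIdx N → Bool) (r k : ℕ) (x : Fin N)
    (hcard : 2 * k ≤ (S1cycA (Adj ω) r x).ncard) (i : ℕ) (hi : i ≤ k) :
    ∃ s t : List (Fin N), s ++ [x] = x :: t ∧ okList (x :: t) ∧ (x :: t).IsChain (Adj ω) ∧
      s.length ≤ (2 * r + 1) * i ∧ hd (x :: t) x ≤ 2 * i ∧ i ≤ mB (x :: t) := by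
  induction i with
  | zero =>
    refine ⟨[], [], rfl, trivial, List.isChain_singleton _, by simp, ?_, Nat.zero_le _⟩
    have : hd [x] x = 0 := by
      unfold hd
      rw [Finset.card_eq_zero, Finset.filter_eq_empty_iff]
      intro y _ h
      exact h.elim
    omega
  | succ i ih =>
    obtain ⟨s, t, hst, hok, hc, hlen, hhd, hm⟩ := ih (by omega)
    obtain ⟨y, hy, hye⟩ : ∃ y ∈ S1cycA (Adj ω) r x, ¬ isEdge (x :: t) x y := by
      by_contra hcon
      push Not at hcon
      have hsub : S1cycA (Adj ω) r x ⊆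
          ((Finset.univ.filter (fun y => isEdge (x :: t) x y) : Finset (Fin N)) : Set (Fin N)) := by
        intro y hy
        simpa using hcon y hy
      have := Set.ncard_le_ncard hsub (Finset.finite_toSet _)
      rw [Set.ncard_coe_finset] at this
      unfold hd at hhd
      omega
    obtain ⟨-, l, γ, hl, hl', h0, h1, hγl, hp, hs⟩ := hy
    subst h0
    subst h1
    obtain ⟨g1, g2, g3, g4⟩ := append_cycle ω γ t l hl hγl hp hs hok hc hye
    obtain ⟨s', hs'len, hs'⟩ := app_eq γ (γ 0 :: t) l
    obtain ⟨t', ht'⟩ := app_head γ t l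
    rw [hγl] at ht'
    rw [ht'] at g1 g2 g3 g4 hs'
    refine ⟨s' ++ s, t', ?_, g1, g2, ?_, by omega, by omega⟩
    · rw [hs', List.append_assoc, hst]
    · rw [List.length_append, hs'len]
      have : (2 * r + 1) * (i + 1) = (2 * r + 1) * i + (2 * r + 1) := by ring
      omega

lemma cyc_card_lt {N : ℕ} (ω : EdgeIdx N → Bool) (r k : ℕ) (x : Fin N) {q : ℝ} (hq : 1 ≤ q)
    (hcnt : ∀ n ≤ (2 * r + 1) * k, cnt ω q n [x] < q ^ k) :
    (S1cycA (Adj ω) r x).ncard < 2 * k := by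
  by_contra hcon
  obtain ⟨s, t, hst, hok, hc, hlen, -, hm⟩ := cyc_iter ω r k x (by omega) k le_rfl
  rw [← hst] at hok hc hm
  have h1 := cnt_ge_of_walk ω (by linarith : 0 ≤ q) s x [] hok hc
  have h2 := hcnt _ hlen
  have h3 : q ^ k ≤ q ^ mB (s ++ [x]) := pow_le_pow_right₀ hq hm
  linarith

/-- cycles may be traversed backwards -/
lemma cyc_symm {N : ℕ} (ω : EdgeIdx N → Bool) (r : ℕ) (x y : Fin N)
    (h : x ∈ S1cycA (Adj ω) r y) : y ∈ S1cycA (Adj ω) r x := by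
  obtain ⟨hadj, l, γ, hl, hl', h0, h1, hγl, hp, hs⟩ := h
  refine ⟨adj_symm hadj, l, fun i => if i = 0 then x else γ (l + 1 - i), hl, hl', by simp, ?_, ?_,
    ?_, ?_⟩
  · simp [hγl]
  · have : l ≠ 0 := by omega
    simp [this, h1]
  · intro i hi
    by_cases hi0 : i = 0
    · subst hi0
      simp only [if_true, zero_add, one_ne_zero, if_false, Nat.add_sub_cancel, hγl]
      exact adj_symm hadj
    · simp only [hi0, if_false, Nat.add_eq_zero_iff, one_ne_zero, and_false]
      have h2 := hp (l - i) (by omega)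
      have e1 : l + 1 - (i + 1) = l - i := by omega
      have e2 : l + 1 - i = l - i + 1 := by omega
      rw [e1, e2]
      exact adj_symm h2
  · intro i j hij hj hne
    have hj0 : j ≠ 0 := by omega
    by_cases hi0 : i = 0
    · subst hi0
      simp only [if_true, hj0, if_false]
      rw [← h1]
      exact hs 1 (l + 1 - j) (by omega) (by omega) (by omega)
    · simp only [hi0, hj0, if_false]
      exact (hs (l + 1 - j) (l + 1 - i) (by omega) (by omega) (by omega)).symm

/-- a triangle through `x` -/
lemma cyc_triangle {N : ℕ} (ω : EdgeIdx N → Bool) (r : ℕ) (hr : 1 ≤ r) (x y z : Fin N)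
    (h1 : Adj ω x y) (h2 : Adj ω y z) (h3 : Adj ω z x) : y ∈ S1cycA (Adj ω) r x := by
  refine ⟨h1, 3, fun i => if i = 1 then y else if i = 2 then z else x, le_rfl, by omega, by simp,
    by simp, by simp, ?_, ?_⟩
  · intro i hi
    interval_cases i
    · simpa using h1
    · simpa using h2
    · simpa using h3
  · intro i j hij hj hne
    have n1 := adj_ne h1
    have n2 := adj_ne h2
    have n3 := adj_ne h3
    interval_cases j <;> interval_cases i <;> simp_all [Ne.symm]

end GRGAux

namespace GRGAux
open GRG
open scoped Classical

/-! ### Part 6: degree estimates -/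

lemma ncard_setOf {N : ℕ} (P : Fin N → Prop) :
    {y | P y}.ncard = (Finset.univ.filter P).card := by
  rw [← Set.ncard_coe_finset]
  congr 1
  ext; simp

/-- The edge `{x,y}` as a set of edges. -/
noncomputable def E1 {N : ℕ} (x y : Fin N) : Finset (EdgeIdx N) :=
  if h : x ≠ y then {ed x y h} else ∅

lemma E1_ne {N : ℕ} {x y : Fin N} (h : x ≠ y) : E1 x y = {ed x y h} := dif_pos h

lemma allOpen_E1 {N : ℕ} (ω : EdgeIdx N → Bool) {x y : Fin N} (h : Adj ω x y) :
    allOpen (E1 x y) ω := by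
  intro e he
  rw [E1_ne (adj_ne h), Finset.mem_singleton] at he
  subst he
  exact (adj_iff ω x y (adj_ne h)).1 h

lemma E1_disjoint {N : ℕ} {x y x' y' : Fin N}
    (h : ¬ ((x = x' ∧ y = y') ∨ (x = y' ∧ y = x'))) : Disjoint (E1 x y) (E1 x' y') := by
  unfold E1
  split_ifs with h1 h2
  · rw [Finset.disjoint_singleton]
    intro hcon
    exact h ((ed_eq_iff _ _ _ _ _ _).1 hcon)
  all_goals simp

lemma prod_E1 {N : ℕ} (w : Fin N → ℝ) {x y : Fin N} (h : x ≠ y) :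
    ∏ a ∈ E1 x y, pe w a = pGRG w x y := by
  rw [E1_ne h, Finset.prod_singleton, pe_ed]

lemma star_tail {N : ℕ} {w : Fin N → ℝ} (hw : ∀ x, 0 < w x) (x : Fin N) (T : Finset (Fin N))
    (θ : ℝ) (hθ : 0 ≤ θ) (k : ℕ) (M : ℝ) (hM : ∑ y ∈ T, w x * w y / ∑ z, w z ≤ M) :
    (grgMeasure w).real {ω | k ≤ (T.filter (fun y => Adj ω x y)).card} ≤
      exp (θ * M) / (1 + θ) ^ k := by
  refine (chernoff_pattern hw (T.filter (fun y => x ≠ y)) (fun y => E1 x y) θ hθ k _ ?_).trans ?_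
  · intro ω hω
    refine ⟨T.filter (fun y => Adj ω x y), ?_, hω, ?_, ?_⟩
    · intro y hy
      rw [Finset.mem_filter] at hy ⊢
      exact ⟨hy.1, adj_ne hy.2⟩
    · intro y hy y' hy' hne
      have h1 := adj_ne (Finset.mem_filter.1 hy).2
      apply E1_disjoint
      rintro (⟨_, h⟩ | ⟨_, h⟩)
      · exact hne h
      · exact h1 h.symm
    · intro y hy
      exact allOpen_E1 ω (Finset.mem_filter.1 hy).2
  · gcongr
    refine le_trans ?_ hM
    calc ∑ i ∈ T.filter (fun y => x ≠ y), ∏ a ∈ E1 x i, pe w a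
        = ∑ i ∈ T.filter (fun y => x ≠ y), pGRG w x i := by
          refine Finset.sum_congr rfl fun y hy => prod_E1 w (Finset.mem_filter.1 hy).2
      _ ≤ ∑ i ∈ T.filter (fun y => x ≠ y), w x * w i / ∑ z, w z :=
          Finset.sum_le_sum fun y _ => pGRG_le hw _ _
      _ ≤ _ := by
          refine Finset.sum_le_sum_of_subset_of_nonneg (Finset.filter_subset _ _) ?_
          intro y _ _
          have := hw x
          have := hw y
          have : 0 ≤ ∑ z, w z := Finset.sum_nonneg fun z _ => (hw z).le
          positivity

lemma deg_upper {N : ℕ} {w : Fin N → ℝ} (hw : ∀ x, 0 < w x) (x : Fin N)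
    (θ : ℝ) (hθ : 0 ≤ θ) (k : ℕ) :
    (grgMeasure w).real {ω | k ≤ degA (Adj ω) x} ≤ exp (θ * w x) / (1 + θ) ^ k := by
  have hW : 0 < ∑ z, w z := Finset.sum_pos (fun z _ => hw z) ⟨x, Finset.mem_univ _⟩
  have h := star_tail hw x Finset.univ θ hθ k (w x) (by
    rw [← Finset.sum_div, ← Finset.mul_sum]
    rw [mul_div_assoc, div_self hW.ne', mul_one])
  refine le_trans (le_of_eq ?_) h
  congr 1
  ext ω
  simp only [Set.mem_ofPred_eq, degA, ncard_setOf]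

lemma big_nbrs {N : ℕ} {w : Fin N → ℝ} (hw : ∀ x, 0 < w x) (x : Fin N)
    (θ : ℝ) (hθ : 0 ≤ θ) (k : ℕ) (θ' κ : ℝ) (hθ' : 0 ≤ θ')
    (hκ : (∑ x, w x ^ 2) / (∑ x, w x) ≤ κ) :
    (grgMeasure w).real {ω | k ≤
      (Finset.univ.filter (fun y => w x ≤ θ' * w y ∧ Adj ω x y)).card} ≤
      exp (θ * (θ' * κ)) / (1 + θ) ^ k := by
  have hW : 0 < ∑ z, w z := Finset.sum_pos (fun z _ => hw z) ⟨x, Finset.mem_univ _⟩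
  have h := star_tail hw x (Finset.univ.filter (fun y => w x ≤ θ' * w y)) θ hθ k (θ' * κ) (by
    calc ∑ y ∈ Finset.univ.filter (fun y => w x ≤ θ' * w y), w x * w y / ∑ z, w z
        ≤ ∑ y ∈ Finset.univ.filter (fun y => w x ≤ θ' * w y), θ' * (w y ^ 2 / ∑ z, w z) := by
          refine Finset.sum_le_sum fun y hy => ?_
          have h1 := (Finset.mem_filter.1 hy).2
          have := hw y
          rw [← mul_div_assoc]
          refine div_le_div_of_nonneg_right ?_ hW.le
          nlinarith
      _ ≤ ∑ y, θ' * (w y ^ 2 / ∑ z, w z) := by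
          refine Finset.sum_le_sum_of_subset_of_nonneg (Finset.filter_subset _ _) ?_
          intro y _ _
          positivity
      _ = θ' * ((∑ y, w y ^ 2) / ∑ z, w z) := by
          rw [← Finset.mul_sum, Finset.sum_div]
      _ ≤ _ := by gcongr)
  refine le_trans (le_of_eq ?_) h
  congr 1
  ext ω
  simp only [Set.mem_ofPred_eq, Finset.filter_filter]

lemma cherry_tail {N : ℕ} {w : Fin N → ℝ} (hw : ∀ x, 0 < w x) (x : Fin N) (r : ℕ) (hr : 1 ≤ r)
    (θ : ℝ) (hθ : 0 ≤ θ) (k : ℕ) (θ' κ : ℝ) (hθ' : 0 ≤ θ')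
    (hκ : (∑ x, w x ^ 2) / (∑ x, w x) ≤ κ) :
    (grgMeasure w).real {ω | k ≤
      (Finset.univ.filter (fun y => Adj ω x y ∧ y ∉ S1cycA (Adj ω) r x ∧
        ∃ z, z ≠ x ∧ Adj ω y z ∧ w x ≤ θ' * w z)).card} ≤
      exp (θ * (θ' * κ ^ 2)) / (1 + θ) ^ k := by
  have hW : 0 < ∑ z, w z := Finset.sum_pos (fun z _ => hw z) ⟨x, Finset.mem_univ _⟩
  set s : Finset (Fin N × Fin N) := Finset.univ.filter (fun p =>
    (x ≠ p.1 ∧ p.1 ≠ p.2 ∧ p.2 ≠ x) ∧ w x ≤ θ' * w p.2) with hs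
  refine (chernoff_pattern hw s (fun p => E1 x p.1 ∪ E1 p.1 p.2) θ hθ k _ ?_).trans ?_
  · intro ω hω
    set Y := Finset.univ.filter (fun y => Adj ω x y ∧ y ∉ S1cycA (Adj ω) r x ∧
        ∃ z, z ≠ x ∧ Adj ω y z ∧ w x ≤ θ' * w z) with hY
    have hch : ∀ y, ∃ z, y ∈ Y → z ≠ x ∧ Adj ω y z ∧ w x ≤ θ' * w z := by
      intro y
      by_cases hy : y ∈ Y
      · obtain ⟨z, hz⟩ := (Finset.mem_filter.1 hy).2.2.2
        exact ⟨z, fun _ => hz⟩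
      · exact ⟨y, fun h => absurd h hy⟩
    choose z hz using hch
    have hYa : ∀ y ∈ Y, Adj ω x y := fun y hy => (Finset.mem_filter.1 hy).2.1
    have hYc : ∀ y ∈ Y, y ∉ S1cycA (Adj ω) r x := fun y hy => (Finset.mem_filter.1 hy).2.2.1
    refine ⟨Y.image (fun y => (y, z y)), ?_, ?_, ?_, ?_⟩
    · intro p hp
      obtain ⟨y, hy, rfl⟩ := Finset.mem_image.1 hp
      obtain ⟨a, b, c⟩ := hz y hy
      rw [hs, Finset.mem_filter]
      exact ⟨Finset.mem_univ _, ⟨adj_ne (hYa y hy), adj_ne b, a⟩, c⟩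
    · rw [Finset.card_image_of_injective _ (fun a b h => (Prod.mk.inj h).1)]
      exact hω
    · intro p hp p' hp' hne
      obtain ⟨y, hy, rfl⟩ := Finset.mem_image.1 hp
      obtain ⟨y', hy', rfl⟩ := Finset.mem_image.1 hp'
      have hyy : y ≠ y' := by rintro rfl; exact hne rfl
      obtain ⟨a, b, c⟩ := hz y hy
      obtain ⟨a', b', c'⟩ := hz y' hy'
      have n1 := adj_ne (hYa y hy)
      have n2 := adj_ne (hYa y' hy')
      simp only [Function.onFun, Finset.disjoint_union_left, Finset.disjoint_union_right]
      refine ⟨⟨E1_disjoint ?_, E1_disjoint ?_⟩, ⟨E1_disjoint ?_, E1_disjoint ?_⟩⟩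
      · rintro (⟨_, h⟩ | ⟨h, _⟩)
        · exact hyy h
        · exact n2 h
      · rintro (⟨h, _⟩ | ⟨_, h⟩)
        · exact n1 h.symm
        · exact a h
      · rintro (⟨h, _⟩ | ⟨h, _⟩)
        · exact n2 h
        · exact a' h.symm
      · rintro (⟨h, _⟩ | ⟨h, h'⟩)
        · exact hyy h
        · rw [h'] at b
          exact hYc y hy (cyc_triangle ω r hr x y y' (hYa y hy) b (adj_symm (hYa y' hy')))
    · intro p hp
      obtain ⟨y, hy, rfl⟩ := Finset.mem_image.1 hp
      intro e he
      rcases Finset.mem_union.1 he with h | h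
      · exact allOpen_E1 ω (hYa y hy) e h
      · exact allOpen_E1 ω (hz y hy).2.1 e h
  · gcongr
    calc ∑ p ∈ s, ∏ a ∈ E1 x p.1 ∪ E1 p.1 p.2, pe w a
        ≤ ∑ p ∈ s, θ' * ((w p.1 ^ 2 / ∑ z, w z) * (w p.2 ^ 2 / ∑ z, w z)) := by
          refine Finset.sum_le_sum fun p hp => ?_
          obtain ⟨⟨a, b, c⟩, d⟩ := (Finset.mem_filter.1 hp).2
          rw [Finset.prod_union, prod_E1 w a, prod_E1 w b]
          · have g1 := pGRG_le hw x p.1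
            have g2 := pGRG_le hw p.1 p.2
            have h1 := hw x
            have h2 := hw p.1
            have h3 := hw p.2
            calc pGRG w x p.1 * pGRG w p.1 p.2 ≤
                (w x * w p.1 / ∑ z, w z) * (w p.1 * w p.2 / ∑ z, w z) := by
                  gcongr
                  exact (pGRG_mem hw _ _).1
              _ = (w x * w p.2) * (w p.1 ^ 2 / ∑ z, w z) / ∑ z, w z := by ring
              _ ≤ (θ' * w p.2 * w p.2) * (w p.1 ^ 2 / ∑ z, w z) / ∑ z, w z := by gcongr
              _ = _ := by ring
          · apply E1_disjoint
            rintro (⟨h, _⟩ | ⟨h, _⟩)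
            · exact a h
            · exact c h.symm
      _ ≤ ∑ p : Fin N × Fin N, θ' * ((w p.1 ^ 2 / ∑ z, w z) * (w p.2 ^ 2 / ∑ z, w z)) := by
          refine Finset.sum_le_sum_of_subset_of_nonneg (Finset.subset_univ _) ?_
          intro y _ _
          positivity
      _ = θ' * ((∑ y, w y ^ 2) / ∑ z, w z) ^ 2 := by
          rw [← Finset.mul_sum, Fintype.sum_prod_type, sq, Finset.sum_div, Finset.sum_mul_sum]
      _ ≤ _ := by gcongr

lemma exp_neg_one_le_half : exp (-1) ≤ 1 / 2 := by
  rw [exp_neg, ← one_div]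
  have := add_one_le_exp (1 : ℝ)
  exact one_div_le_one_div_of_le (by norm_num) (by linarith)

lemma integral_exp_neg {N : ℕ} {w : Fin N → ℝ} (hw : ∀ x, 0 < w x) (E : Finset (EdgeIdx N)) :
    ∫ ω, exp (-((E.filter (fun e => ω e = true)).card : ℝ)) ∂(grgMeasure w) ≤
      exp (-(1 / 2 * ∑ e ∈ E, pe w e)) := by
  have h := grg_integral_prod hw (fun e b => if e ∈ E then (if b = true then exp (-1) else 1) else 1)
  have h2 : ∀ ω : EdgeIdx N → Bool,
      (∏ e, if e ∈ E then (if ω e = true then exp (-1) else (1 : ℝ)) else 1)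
      = exp (-((E.filter (fun e => ω e = true)).card : ℝ)) := by
    intro ω
    rw [Finset.prod_ite_mem, Finset.univ_inter, Finset.prod_ite, Finset.prod_const,
      Finset.prod_const_one, mul_one, ← exp_nat_mul]
    simp
  simp only [h2] at h
  rw [h]
  calc _ ≤ ∏ e, exp (if e ∈ E then -(1 / 2 * pe w e) else 0) := by
        refine Finset.prod_le_prod ?_ ?_
        · intro e _
          have := pe_mem hw e
          have h1 : 0 ≤ 1 - pe w e := by linarith [this.2]
          have h0 := this.1
          split_ifs <;> simp <;> positivity
        · intro e _
          have := pe_mem hw e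
          by_cases he : e ∈ E
          · simp only [if_pos he, Bool.false_eq_true, if_false, if_true]
            have h3 := add_one_le_exp (-(1 / 2 * pe w e))
            have h4 := mul_le_mul_of_nonneg_left exp_neg_one_le_half this.1
            linarith
          · simp [if_neg he]
    _ = exp (-(1 / 2 * ∑ e ∈ E, pe w e)) := by
        rw [← exp_sum]
        congr 1
        rw [Finset.sum_ite_mem, Finset.univ_inter, Finset.sum_neg_distrib, Finset.mul_sum]

lemma deg_lower {N : ℕ} {w : Fin N → ℝ} (hw : ∀ x, 0 < w x) (x : Fin N) (a : ℝ)
    (h1 : ∀ y z, w y * w z ≤ ∑ z, w z) (h2 : w x ≤ (∑ z, w z) / 2) :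
    (grgMeasure w).real {ω | (degA (Adj ω) x : ℝ) ≤ w x / 8 - a} ≤ exp (-a) := by
  have hW : 0 < ∑ z, w z := Finset.sum_pos (fun z _ => hw z) ⟨x, Finset.mem_univ _⟩
  set E : Finset (EdgeIdx N) := Finset.univ.biUnion (fun y => E1 x y) with hE
  have hdisj : (Finset.univ.filter (fun y => x ≠ y) : Set (Fin N)).PairwiseDisjoint
      (fun y => E1 x y) := by
    intro y hy y' hy' hne
    have n1 := (Finset.mem_filter.1 hy).2
    apply E1_disjoint
    rintro (⟨_, h⟩ | ⟨_, h⟩)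
    · exact hne h
    · exact n1 h.symm
  have hsum : w x / 4 ≤ ∑ e ∈ E, pe w e := by
    have hsub : (Finset.univ.filter (fun y => x ≠ y)).biUnion (fun y => E1 x y) ⊆ E := by
      rw [hE]
      exact Finset.biUnion_subset_biUnion_of_subset_left _ (Finset.subset_univ _)
    refine le_trans ?_ (Finset.sum_le_sum_of_subset_of_nonneg hsub
      (fun e _ _ => (pe_mem hw e).1))
    rw [Finset.sum_biUnion hdisj]
    calc w x / 4 ≤ w x * ((∑ z, w z) - w x) / (2 * ∑ z, w z) := by
          rw [div_le_div_iff₀ (by norm_num) (by positivity)]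
          have := hw x
          nlinarith
      _ = ∑ y ∈ Finset.univ.filter (fun y => x ≠ y), w x * w y / (2 * ∑ z, w z) := by
          rw [← Finset.sum_div, ← Finset.mul_sum]
          congr 2
          rw [← Finset.sum_erase_eq_sub (Finset.mem_univ x)]
          refine Finset.sum_congr ?_ fun _ _ => rfl
          ext y; simp [eq_comm]
      _ ≤ _ := by
          refine Finset.sum_le_sum fun y hy => ?_
          rw [E1_ne (Finset.mem_filter.1 hy).2, Finset.sum_singleton, pe_ed]
          unfold pGRG
          have g1 := hw x
          have g2 := hw y
          have g3 := h1 x y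
          gcongr
          linarith
  have hcard : ∀ ω : EdgeIdx N → Bool, (E.filter (fun e => ω e = true)).card ≤ degA (Adj ω) x := by
    intro ω
    rw [hE, Finset.filter_biUnion]
    refine Finset.card_biUnion_le.trans ?_
    rw [degA, ncard_setOf, Finset.card_filter]
    refine Finset.sum_le_sum fun y _ => ?_
    by_cases hxy : x = y
    · simp [E1, hxy]
    · rw [E1_ne hxy, Finset.filter_singleton]
      have hA := adj_iff ω x y hxy
      split_ifs with c1 c2 c2
      · simp
      · exact absurd (hA.2 c1) c2
      · simp
      · simp
  have hm := markov hw (fun ω => exp (-((E.filter (fun e => ω e = true)).card : ℝ)))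
    (fun ω => (exp_pos _).le) (exp_pos (-(w x / 8 - a)))
    {ω | (degA (Adj ω) x : ℝ) ≤ w x / 8 - a} (by
      intro ω hω
      apply exp_le_exp.2
      have h3 : ((E.filter (fun e => ω e = true)).card : ℝ) ≤ degA (Adj ω) x := by
        exact_mod_cast hcard ω
      have h4 : (degA (Adj ω) x : ℝ) ≤ w x / 8 - a := hω
      linarith)
  refine hm.trans ?_
  rw [div_le_iff₀ (exp_pos _), ← exp_add]
  refine (integral_exp_neg hw E).trans ?_
  apply exp_le_exp.2
  linarith

end GRGAux

namespace GRGAux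
open GRG
open scoped Classical

/-! ### Part 7: combination -/

/-- The removed edges. -/
def Rem {N : ℕ} (ω : EdgeIdx N → Bool) (r : ℕ) (x y : Fin N) : Prop :=
  Adj ω x y ∧ ¬ AdjPA (Adj ω) r x y

lemma Rem_symm {N : ℕ} (ω : EdgeIdx N → Bool) (r : ℕ) (x y : Fin N) (h : Rem ω r x y) :
    Rem ω r y x := by
  refine ⟨adj_symm h.1, fun hcon => h.2 ?_⟩
  obtain ⟨⟨a, b, c⟩, d, e⟩ := hcon
  exact ⟨⟨adj_symm a, c, b⟩, e, d⟩

lemma sub_eq_relMat {N : ℕ} (ω : EdgeIdx N → Bool) (r : ℕ) :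
    adjMatrix ω - adjMatrixPA (Adj ω) r = relMat (Rem ω r) := by
  ext x y
  rw [Matrix.sub_apply, adjMatrix_eq]
  unfold adjMatrixPA relMat Rem
  by_cases h1 : Adj ω x y
  · by_cases h2 : AdjPA (Adj ω) r x y
    · simp [h1, h2]
    · simp [h1, h2]
  · have h2 : ¬ AdjPA (Adj ω) r x y := fun h => h1 h.1.1
    simp [h1, h2]

lemma prec_deg {N : ℕ} {A : Fin N → Fin N → Prop} {x y : Fin N} (h : precA A x y) :
    degA A x ≤ degA A y ∧ x ≠ y := by
  rcases h with h | ⟨h, h'⟩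
  · exact ⟨h.le, by rintro rfl; omega⟩
  · exact ⟨h.le, h'.ne'⟩

lemma deg_Rem {N : ℕ} {w : Fin N → ℝ} (hw : ∀ x, 0 < w x) (ω : EdgeIdx N → Bool) (r k k5 : ℕ)
    (θ θ' K a b : ℝ) (hK : 0 ≤ K) (hb : 0 ≤ b)
    (hab : a ≤ b * K) (hθ' : (16 + 8 * b) * θ ≤ θ')
    (hc : ∀ x, (S1cycA (Adj ω) r x).ncard < 2 * k)
    (hu : ∀ z, (degA (Adj ω) z : ℝ) < θ * w z + K)
    (hl : ∀ x, w x / 8 - a < degA (Adj ω) x)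
    (hch : ∀ x, (Finset.univ.filter (fun y => Adj ω x y ∧ y ∉ S1cycA (Adj ω) r x ∧
        ∃ z, z ≠ x ∧ Adj ω y z ∧ w x ≤ θ' * w z)).card < k5)
    (hbn : ∀ x, (Finset.univ.filter (fun y => w x ≤ θ' * w y ∧ Adj ω x y)).card < k5)
    (x : Fin N) :
    ((Finset.univ.filter (fun y => Rem ω r x y)).card : ℝ) ≤ 2 * k + 2 * K + 2 * k5 := by
  by_cases hD : (degA (Adj ω) x : ℝ) < 2 * K
  · have h1 : (Finset.univ.filter (fun y => Rem ω r x y)).card ≤ degA (Adj ω) x := by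
      rw [degA, ncard_setOf]
      refine Finset.card_le_card fun y hy => ?_
      rw [Finset.mem_filter] at hy ⊢
      exact ⟨hy.1, hy.2.1⟩
    have h2 : ((Finset.univ.filter (fun y => Rem ω r x y)).card : ℝ) ≤ degA (Adj ω) x := by
      exact_mod_cast h1
    have h3 : (0 : ℝ) ≤ k := Nat.cast_nonneg _
    have h4 : (0 : ℝ) ≤ k5 := Nat.cast_nonneg _
    linarith
  · push Not at hD
    have hcmp : ∀ z, degA (Adj ω) x ≤ degA (Adj ω) z → w x ≤ θ' * w z := by
      intro z hz
      have hz' : (degA (Adj ω) x : ℝ) ≤ degA (Adj ω) z := by exact_mod_cast hz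
      have h1 := hu z
      have h2 := hl x
      have h3 : (degA (Adj ω) x : ℝ) ≤ 2 * (θ * w z) := by linarith
      have h4 : b * K ≤ b * ((degA (Adj ω) x : ℝ) / 2) := by gcongr; linarith
      have h5 : w x ≤ (8 + 4 * b) * (degA (Adj ω) x : ℝ) := by linarith
      have h6 : (8 + 4 * b) * (degA (Adj ω) x : ℝ) ≤ (8 + 4 * b) * (2 * (θ * w z)) := by gcongr
      have h7 : (16 + 8 * b) * θ * w z ≤ θ' * w z := mul_le_mul_of_nonneg_right hθ' (hw z).le
      nlinarith
    have hsub : Finset.univ.filter (fun y => Rem ω r x y) ⊆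
        (Finset.univ.filter (fun y => y ∈ S1cycA (Adj ω) r x)) ∪
        ((Finset.univ.filter (fun y => Adj ω x y ∧ y ∉ S1cycA (Adj ω) r x ∧
        ∃ z, z ≠ x ∧ Adj ω y z ∧ w x ≤ θ' * w z)) ∪
        (Finset.univ.filter (fun y => w x ≤ θ' * w y ∧ Adj ω x y))) := by
      intro y hy
      obtain ⟨hadj, hn⟩ := (Finset.mem_filter.1 hy).2
      simp only [Finset.mem_union, Finset.mem_filter, Finset.mem_univ, true_and]
      by_cases c1 : y ∈ S1cycA (Adj ω) r x
      · exact Or.inl c1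
      · right
        have c2 : x ∉ S1cycA (Adj ω) r y := fun h => c1 (cyc_symm ω r x y h)
        by_cases c3 : y ∈ S1duA (Adj ω) r x
        · left
          obtain ⟨_, _, _, z, hz1, _, hz2⟩ := c3
          obtain ⟨g1, g2⟩ := prec_deg hz2
          exact ⟨hadj, c1, z, g2.symm, hz1, hcmp z g1⟩
        · by_cases c4 : x ∈ S1duA (Adj ω) r y
          · right
            exact ⟨hcmp y (prec_deg c4.2.2.1).1, hadj⟩
          · exact absurd ⟨⟨hadj, c1, c2⟩, c3, c4⟩ hn
    have h1 := (Finset.card_le_card hsub).trans ((Finset.card_union_le _ _).trans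
      (Nat.add_le_add_left (Finset.card_union_le _ _) _))
    have h2 := hc x
    have h2' : (S1cycA (Adj ω) r x).ncard =
      (Finset.univ.filter (fun y => y ∈ S1cycA (Adj ω) r x)).card := ncard_setOf _
    have h3 := hch x
    have h4 := hbn x
    have h5 : (Finset.univ.filter (fun y => Rem ω r x y)).card ≤ 2 * k + 2 * k5 := by omega
    have h6 : ((Finset.univ.filter (fun y => Rem ω r x y)).card : ℝ) ≤ 2 * k + 2 * k5 := by
      exact_mod_cast h5
    linarith

lemma union_event {N : ℕ} {w : Fin N → ℝ} (hw : ∀ x, 0 < w x) {ι : Type} (s : Finset ι)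
    (P : ι → (EdgeIdx N → Bool) → Prop) (p : ℝ)
    (h : ∀ i ∈ s, (grgMeasure w).real {ω | P i ω} ≤ p) :
    (grgMeasure w).real {ω | ∃ i ∈ s, P i ω} ≤ s.card * p := by
  have := grg_prob hw
  have e : {ω | ∃ i ∈ s, P i ω} = ⋃ i ∈ s, {ω | P i ω} := by
    ext; simp
  rw [e]
  refine (measureReal_biUnion_finset_le _ _).trans ?_
  refine (Finset.sum_le_sum h).trans ?_
  simp

lemma exp_div_pow_le {x y θ : ℝ} (hθ : 0 ≤ θ) {c : ℝ} (k : ℕ) (hk : y ≤ k)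
    (hx : x - Real.log (1 + θ) * y ≤ c) : exp x / (1 + θ) ^ k ≤ exp c := by
  have h1 : 0 ≤ Real.log (1 + θ) := Real.log_nonneg (by linarith)
  have h2 : (1 + θ) ^ k = exp (k * Real.log (1 + θ)) := by
    rw [exp_nat_mul, exp_log (by linarith)]
  rw [h2, ← exp_sub]
  apply exp_le_exp.2
  have := mul_le_mul_of_nonneg_left hk h1
  linarith

lemma good_event {N : ℕ} {w : Fin N → ℝ} (hw : ∀ x, 0 < w x) (r k l : ℕ) (hr : 1 ≤ r) (hl : 1 ≤ l)
    (q O B κ L Λ lam θ θ' K b ν T : ℝ)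
    (hT : (N : ℝ) = exp T) (hq : 1 ≤ q) (hO : 1 ≤ O) (hB : ∀ x, w x ≤ B) (hL0 : 0 ≤ L)
    (hκ : (∑ x, w x ^ 2) / (∑ x, w x) ≤ κ) (hκ1 : 1 ≤ κ) (hΛ : 4 ≤ Λ) (hκΛ : κ + 1 ≤ Λ / 2)
    (hBO : B * (κ + 1) ≤ O)
    (h1 : L * (B / ∑ x, w x) * q * O * exp (8 * L / Λ) ≤ 1)
    (h2 : L * (B * (B / ∑ x, w x)) * q * exp (8 * L / Λ) ≤ 1)
    (hlL : (l : ℝ) + 2 ≤ L) (hkL : (((2 * r + 1) * k : ℕ) : ℝ) + 1 ≤ L)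
    (hlam1 : 1 ≤ lam)
    (hp1 : N * ((B + 1) * Λ ^ (l + 1) / lam ^ l) ≤ exp (-(ν * T)))
    (hp2 : N * ((B + 1) * Λ ^ ((2 * r + 1) * k) / q ^ k) ≤ exp (-(ν * T)))
    (hθ0 : 0 ≤ θ) (hθ1 : 1 ≤ Real.log (1 + θ)) (hb : 0 ≤ b) (hK : 0 ≤ K)
    (hK1 : (ν + 2) * T ≤ Real.log (1 + θ) * K) (hTnn : 0 ≤ T)
    (hab : (ν + 1) * T ≤ b * K) (hθ' : (16 + 8 * b) * θ ≤ θ')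
    (hm : θ * (θ' * κ ^ 2) ≤ T)
    (hww : ∀ y z, w y * w z ≤ ∑ z, w z) (hw2 : ∀ x, w x ≤ (∑ z, w z) / 2) :
    1 - (((2 * r + 1) * k + 6 : ℕ) : ℝ) * exp (-(ν * T)) ≤
      (grgMeasure w).real {ω | opNorm (adjMatrix ω - adjMatrixPA (Adj ω) r) ≤
        lam + (2 * k + 4 * K + 2) / lam} := by
  have hprob := grg_prob hw
  have hlam : 0 < lam := by linarith
  set μ := grgMeasure w with hμ
  set p := exp (-(ν * T)) with hp
  have hθ'0 : 0 ≤ θ' := le_trans (by positivity) hθ'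
  have hNp : (N : ℝ) * exp (-((ν + 1) * T)) = p := by
    rw [hT, hp, ← exp_add]; congr 1; ring
  have hB0 : ∀ x : Fin N, 0 < B := fun x => (hw x).trans_le (hB x)
  set k5 := ⌈K⌉₊ with hk5
  have hk5' : (k5 : ℝ) ≤ K + 1 := (Nat.ceil_lt_add_one hK).le
  -- the bad events
  set b1 := {ω : EdgeIdx N → Bool | ∃ u, lam ^ l ≤ cnt ω q (l + 1) [u]} with hb1
  set b2 := {ω : EdgeIdx N → Bool | ∃ n ∈ Finset.range ((2 * r + 1) * k + 1),
    ∃ u, q ^ k ≤ cnt ω q n [u]} with hb2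
  set b3 := {ω : EdgeIdx N → Bool | ∃ z ∈ (Finset.univ : Finset (Fin N)),
    ⌈θ * w z + K⌉₊ ≤ degA (Adj ω) z} with hb3
  set b4 := {ω : EdgeIdx N → Bool | ∃ x ∈ (Finset.univ : Finset (Fin N)),
    (degA (Adj ω) x : ℝ) ≤ w x / 8 - (ν + 1) * T} with hb4
  set b5 := {ω : EdgeIdx N → Bool | ∃ x ∈ (Finset.univ : Finset (Fin N)), k5 ≤
      (Finset.univ.filter (fun y => Adj ω x y ∧ y ∉ S1cycA (Adj ω) r x ∧
        ∃ z, z ≠ x ∧ Adj ω y z ∧ w x ≤ θ' * w z)).card} with hb5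
  set b6 := {ω : EdgeIdx N → Bool | ∃ x ∈ (Finset.univ : Finset (Fin N)), k5 ≤
      (Finset.univ.filter (fun y => w x ≤ θ' * w y ∧ Adj ω x y)).card} with hb6
  have q1 : μ.real b1 ≤ p := by
    refine (cnt_event hw q O B κ L Λ hq hO hB hL0 hκ hΛ hκΛ hBO h1 h2 (l + 1) ?_ _
      (pow_pos hlam l)).trans hp1
    push_cast; linarith
  have q2 : μ.real b2 ≤ (((2 * r + 1) * k + 1 : ℕ) : ℝ) * p := by
    have := union_event hw (Finset.range ((2 * r + 1) * k + 1))
      (fun n ω => ∃ u, q ^ k ≤ cnt ω q n [u]) p ?_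
    · rwa [Finset.card_range] at this
    · intro n hn
      have hn' : n ≤ (2 * r + 1) * k := by
        have := Finset.mem_range.1 hn; omega
      have hnr : (n : ℝ) ≤ (((2 * r + 1) * k : ℕ) : ℝ) := by exact_mod_cast hn'
      refine (cnt_event hw q O B κ L Λ hq hO hB hL0 hκ hΛ hκΛ hBO h1 h2 n (by linarith) _
        (pow_pos (by linarith) k)).trans (le_trans ?_ hp2)
      rcases Nat.eq_zero_or_pos N with h0 | h0
      · simp [h0]
      · have := hB0 ⟨0, h0⟩
        gcongr
        linarith
  have q3 : μ.real b3 ≤ p := by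
    have := union_event hw Finset.univ (fun z ω => ⌈θ * w z + K⌉₊ ≤ degA (Adj ω) z)
      (exp (-((ν + 1) * T))) ?_
    · rwa [Finset.card_univ, Fintype.card_fin, hNp] at this
    · intro z _
      refine (deg_upper hw z θ hθ0 _).trans (exp_div_pow_le hθ0 _ (Nat.le_ceil _) ?_)
      have := mul_le_mul_of_nonneg_right hθ1 (mul_nonneg hθ0 (hw z).le)
      nlinarith
  have q4 : μ.real b4 ≤ p := by
    have := union_event hw Finset.univ
      (fun x ω => (degA (Adj ω) x : ℝ) ≤ w x / 8 - (ν + 1) * T)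
      (exp (-((ν + 1) * T))) ?_
    · rwa [Finset.card_univ, Fintype.card_fin, hNp] at this
    · intro x _
      exact deg_lower hw x _ hww (hw2 x)
  have q5 : μ.real b5 ≤ p := by
    have := union_event hw Finset.univ (fun x ω => k5 ≤
      (Finset.univ.filter (fun y => Adj ω x y ∧ y ∉ S1cycA (Adj ω) r x ∧
        ∃ z, z ≠ x ∧ Adj ω y z ∧ w x ≤ θ' * w z)).card)
      (exp (-((ν + 1) * T))) ?_
    · rwa [Finset.card_univ, Fintype.card_fin, hNp] at this
    · intro x _
      refine (cherry_tail hw x r hr θ hθ0 k5 θ' κ hθ'0 hκ).trans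
        (exp_div_pow_le hθ0 _ (Nat.le_ceil _) ?_)
      linarith
  have q6 : μ.real b6 ≤ p := by
    have := union_event hw Finset.univ (fun x ω => k5 ≤
      (Finset.univ.filter (fun y => w x ≤ θ' * w y ∧ Adj ω x y)).card)
      (exp (-((ν + 1) * T))) ?_
    · rwa [Finset.card_univ, Fintype.card_fin, hNp] at this
    · intro x _
      refine (big_nbrs hw x θ hθ0 k5 θ' κ hθ'0 hκ).trans
        (exp_div_pow_le hθ0 _ (Nat.le_ceil _) ?_)
      have hκκ : θ * (θ' * κ) ≤ θ * (θ' * κ ^ 2) := by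
        gcongr
        nlinarith
      linarith
  set S := {ω | opNorm (adjMatrix ω - adjMatrixPA (Adj ω) r) ≤
        lam + (2 * k + 4 * K + 2) / lam} with hS
  have hcover : (Set.univ : Set (EdgeIdx N → Bool)) ⊆ S ∪ (b1 ∪ (b2 ∪ (b3 ∪ (b4 ∪ (b5 ∪ b6))))) := by
    intro ω _
    by_contra hcon
    simp only [Set.mem_union, not_or] at hcon
    obtain ⟨n0, n1, n2, n3, n4, n5, n6⟩ := hcon
    simp only [hb1, hb2, hb3, hb4, hb5, hb6, Set.mem_ofPred_eq, not_exists, not_and, not_le,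
      Finset.mem_univ, true_imp_iff, Finset.mem_range] at n1 n2 n3 n4 n5 n6
    apply n0
    have hdeg := deg_Rem hw ω r k k5 θ θ' K ((ν + 1) * T) b hK hb hab hθ'
      (fun x => cyc_card_lt ω r k x hq (fun n hn => n2 n (by omega) x))
      (fun z => Nat.lt_ceil.1 (n3 z)) n4 n5 n6
    have hop := opNorm_le_of_nb_count (Adj ω) (Rem ω r) (fun x y h => Rem_symm ω r x y h)
      (fun x y h => h.1) l hl lam hlam1
      (fun u v huv => (nb_le_cnt_single ω hq l u v huv).trans (n1 u).le)
      (2 * k + 2 * K + 2 * k5) hdeg (by positivity)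
    rw [hS, Set.mem_ofPred_eq, sub_eq_relMat]
    refine hop.trans ?_
    have hle : 2 * (k : ℝ) + 2 * K + 2 * k5 ≤ 2 * k + 4 * K + 2 := by linarith
    have := div_le_div_of_nonneg_right hle hlam.le
    linarith
  have h7 : μ.real Set.univ ≤ μ.real S + (μ.real b1 + (μ.real b2 + (μ.real b3 + (μ.real b4 +
      (μ.real b5 + μ.real b6))))) := by
    refine (measureReal_mono hcover).trans ((measureReal_union_le _ _).trans ?_)
    gcongr
    refine (measureReal_union_le _ _).trans ?_
    gcongr
    refine (measureReal_union_le _ _).trans ?_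
    gcongr
    refine (measureReal_union_le _ _).trans ?_
    gcongr
    refine (measureReal_union_le _ _).trans ?_
    gcongr
    exact measureReal_union_le _ _
  rw [probReal_univ] at h7
  push_cast at q2 ⊢
  linarith

end GRGAux

namespace GRGAux
open GRG
open scoped Classical

/-! ### Part 8: asymptotics -/

lemma ev_rpow {a b c : ℝ} (hab : a < b) (hc : 0 < c) :
    ∀ᶠ T : ℝ in Filter.atTop, T ^ a ≤ c * T ^ b := by
  have h := (tendsto_rpow_atTop (sub_pos.2 hab)).eventually_ge_atTop (1 / c)
  filter_upwards [h, Filter.eventually_gt_atTop 0] with T hT h0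
  have e : T ^ b = T ^ a * T ^ (b - a) := by rw [← rpow_add h0]; congr 1; ring
  rw [div_le_iff₀ hc] at hT
  rw [e]
  have h1 : 0 < T ^ a := by positivity
  nlinarith

lemma ev_log {b c : ℝ} (hb : 0 < b) (hc : 0 < c) :
    ∀ᶠ T : ℝ in Filter.atTop, Real.log T ≤ c * T ^ b := by
  have h := (isLittleO_log_rpow_atTop hb).bound hc
  filter_upwards [h, Filter.eventually_gt_atTop 0] with T hT h0
  rw [norm_of_nonneg (by positivity : 0 ≤ T ^ b)] at hT
  exact (le_abs_self _).trans hT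

lemma asym (ε δ C c M : ℝ) (hε : 0 < ε) (hδ' : δ < 1 / 3) (hC : 0 < C)
    (hM : 0 ≤ M) :
    ∀ᶠ T : ℝ in Filter.atTop,
      (6 ≤ T ∧ 10 ≤ Real.log T ∧ Real.log T ≤ T) ∧
      Real.log T + 8 * T / T ^ ((5 : ℝ) / 12) ≤ ε / 4 * T ∧
      C * T ^ δ + 2 ≤ exp (ε / 2 * T) ∧
      (C * T ^ δ + 2 ≤ T ^ ((5 : ℝ) / 12) / 2 ∧ 4 ≤ T ^ ((5 : ℝ) / 12)) ∧
      c * (T / Real.log T) + 3 ≤ T ∧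
      M + 1 ≤ T ∧
      (16 + 8 * Real.log T) * T ^ ((1 : ℝ) / 10) ≤ T ^ ((1 : ℝ) / 5) ∧
      T ^ ((1 : ℝ) / 10) * (T ^ ((1 : ℝ) / 5) * (C * T ^ δ + 1) ^ 2) ≤ T ∧
      Real.log T ≤ T ^ ((1 : ℝ) / 12) ∧
      M * (5 / 12 * Real.log T) ≤ T := by
  have hlog : ∀ d : ℝ, ∀ᶠ T : ℝ in Filter.atTop, d ≤ Real.log T := fun d =>
    Real.tendsto_log_atTop.eventually_ge_atTop d
  filter_upwards [Filter.eventually_ge_atTop (6 + M + 1), hlog 10, hlog (2 * c),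
    ev_log (b := 1) (c := ε / 8) (by norm_num) (by positivity),
    ev_rpow (a := 7 / 12) (b := 1) (c := ε / 64) (by norm_num) (by positivity),
    ev_rpow (a := δ) (b := 1) (c := 1 / (2 * C)) (by linarith) (by positivity),
    ev_rpow (a := δ) (b := 5 / 12) (c := 1 / (4 * C)) (by linarith) (by positivity),
    ev_rpow (a := 0) (b := 5 / 12) (c := 1 / 8) (by norm_num) (by positivity),
    ev_log (b := 1 / 10) (c := 1 / 16) (by norm_num) (by positivity),
    ev_rpow (a := δ) (b := 1 / 3) (c := 1 / (2 * C)) (by linarith) (by positivity),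
    ev_rpow (a := 0) (b := 1 / 3) (c := 1 / 2) (by norm_num) (by positivity),
    ev_log (b := 1 / 12) (c := 1) (by norm_num) (by positivity),
    ev_log (b := 1) (c := 1 / (M + 1)) (by norm_num) (by positivity)]
    with T h6 h10 h2c f1 f2 f3 f4 f5 f6 f7 f8 f9 f10
  have hT : 0 < T := by linarith
  have hU : 0 < Real.log T := by linarith
  rw [rpow_one] at f1 f2 f3 f10
  rw [rpow_zero] at f5 f8
  have e : ∀ d : ℝ, C * (1 / (d * C) * T) = T / d := fun d => by
    by_cases hd : d = 0
    · simp [hd]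
    · field_simp
  have f3' : C * T ^ δ ≤ T / 2 := by
    calc C * T ^ δ ≤ C * (1 / (2 * C) * T) := by gcongr
      _ = T / 2 := by field_simp
  have f4' : C * T ^ δ ≤ T ^ ((5 : ℝ) / 12) / 4 := by
    calc C * T ^ δ ≤ C * (1 / (4 * C) * T ^ ((5 : ℝ) / 12)) := by gcongr
      _ = T ^ ((5 : ℝ) / 12) / 4 := by field_simp
  have f7' : C * T ^ δ ≤ T ^ ((1 : ℝ) / 3) / 2 := by
    calc C * T ^ δ ≤ C * (1 / (2 * C) * T ^ ((1 : ℝ) / 3)) := by gcongr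
      _ = T ^ ((1 : ℝ) / 3) / 2 := by field_simp
  have g2 : T / T ^ ((5 : ℝ) / 12) = T ^ ((7 : ℝ) / 12) := by
    nth_rewrite 1 [← rpow_one T]
    rw [← rpow_sub hT]; norm_num
  refine ⟨⟨by linarith, h10, ?_⟩, ?_, ?_, ⟨by linarith, by linarith⟩, ?_, by linarith, ?_, ?_,
    by linarith, ?_⟩
  · have := Real.log_le_sub_one_of_pos hT
    linarith
  · rw [mul_div_assoc, g2]; linarith
  · have : T = exp (Real.log T) := (exp_log hT).symm
    calc C * T ^ δ + 2 ≤ T := by linarith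
      _ = exp (Real.log T) := this
      _ ≤ _ := by
        apply exp_le_exp.2
        have : 0 ≤ ε * T := by positivity
        linarith
  · have : c * (T / Real.log T) ≤ T / 2 := by
      rw [← mul_div_assoc, div_le_div_iff₀ hU (by norm_num)]
      nlinarith
    linarith
  · have h1 : T ^ ((1 : ℝ) / 5) = T ^ ((1 : ℝ) / 10) * T ^ ((1 : ℝ) / 10) := by
      rw [← rpow_add hT]; norm_num
    rw [h1]
    gcongr
    linarith
  · have h1 : C * T ^ δ + 1 ≤ T ^ ((1 : ℝ) / 3) := by linarith
    have h0 : 0 ≤ C * T ^ δ + 1 := by positivity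
    calc _ ≤ T ^ ((1 : ℝ) / 10) * (T ^ ((1 : ℝ) / 5) * (T ^ ((1 : ℝ) / 3)) ^ 2) := by gcongr
      _ = T ^ ((29 : ℝ) / 30) := by
        rw [sq, ← rpow_add hT, ← rpow_add hT, ← rpow_add hT]; norm_num
      _ ≤ T ^ (1 : ℝ) := rpow_le_rpow_of_exponent_le (by linarith) (by norm_num)
      _ = T := rpow_one T
  · have h1 : M * (5 / 12 * Real.log T) ≤ (M + 1) * Real.log T := by nlinarith
    have h2 : (M + 1) * Real.log T ≤ (M + 1) * (1 / (M + 1) * T) := by gcongr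
    have h3 : (M + 1) * (1 / (M + 1) * T) = T := by field_simp
    linarith

lemma lam_bound {lam k ν : ℝ} (hlam1 : 1 ≤ lam) (hk : 0 ≤ k) :
    lam + (2 * k + 4 * (10 * (ν + 2) * lam ^ 2) + 2) / lam ≤
      (1 + (2 * k + 2) + 40 * (ν + 2)) * lam := by
  have hlam0 : 0 < lam := by linarith
  have e3 : (2 * k + 4 * (10 * (ν + 2) * lam ^ 2) + 2) / lam =
      (2 * k + 2) / lam + 40 * (ν + 2) * lam := by
    field_simp
    ring
  rw [e3]
  have e4 : (2 * k + 2) / lam ≤ (2 * k + 2) * lam := by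
    rw [div_le_iff₀ hlam0]
    have : 1 ≤ lam * lam := by nlinarith
    nlinarith
  linarith

set_option maxHeartbeats 1000000 in
lemma good_large (ε δ C ν : ℝ) (hε : 0 < ε) (hε' : ε < 1 / 2)
    (hδ' : δ < 1 / 3) (hC : 0 < C) (hν : 0 < ν) (r : ℕ) (hr : 1 ≤ r) :
    ∃ Cν > (0 : ℝ), ∃ C' > (0 : ℝ), ∃ N0 : ℕ, ∀ N : ℕ, N0 ≤ N → ∀ w : Fin N → ℝ,
      (∀ x, 0 < w x) → (∀ x, w x ≤ (N : ℝ) ^ ((1 : ℝ) / 2 - ε)) →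
      (N : ℝ) ^ (-ε) ≤ m1 w → m2 w / m1 w ≤ C * Real.log N ^ δ →
      1 - C' * (N : ℝ) ^ (-ν) ≤ (grgMeasure w).real {ω |
          opNorm (adjMatrix ω - adjMatrixPA (Adj ω) r) ≤
            Cν * Real.sqrt (Real.log N / Real.log (Real.log N))} := by
  set k : ℕ := ⌈4 * (ν + 3) / ε⌉₊ with hk
  set c : ℝ := 24 * (ν + 3) with hc
  set M : ℝ := (((2 * r + 1) * k : ℕ) : ℝ) with hMdef
  have hM : 0 ≤ M := Nat.cast_nonneg _
  refine ⟨1 + (2 * k + 2) + 40 * (ν + 2), by positivity,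
    (((2 * r + 1) * k + 6 : ℕ) : ℝ), by positivity, ?_⟩
  have hev := (Real.tendsto_log_atTop.comp tendsto_natCast_atTop_atTop).eventually
    (asym ε δ C c M hε hδ' hC hM)
  obtain ⟨N0, hN0⟩ := Filter.eventually_atTop.1 hev
  refine ⟨N0, fun N hN w hw hA1 hm1 hm2 => ?_⟩
  have hT := hN0 N hN
  simp only [Function.comp] at hT
  set T := Real.log N with hTdef
  obtain ⟨⟨t6, t10, tU⟩, a2, a3, ⟨a4, a4'⟩, a5, a6, a7, a8, a9, a10⟩ := hT
  set U := Real.log T with hUdef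
  have hT0 : 0 < T := by linarith
  have hU0 : 0 < U := by linarith
  have hN1 : (0 : ℝ) < N := by
    rcases Nat.eq_zero_or_pos N with h | h
    · exfalso
      rw [hTdef, h] at hT0
      simp at hT0
    · exact_mod_cast h
  have hNT : (N : ℝ) = exp T := (exp_log hN1).symm
  have hTU : T = exp U := (exp_log hT0).symm
  have hNpow : ∀ a : ℝ, (N : ℝ) ^ a = exp (a * T) := fun a => by
    rw [rpow_def_of_pos hN1, mul_comm]
  have hTpow : ∀ a : ℝ, T ^ a = exp (a * U) := fun a => by
    rw [rpow_def_of_pos hT0, mul_comm]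
  -- the total weight
  have hW : exp ((1 - ε) * T) ≤ ∑ z, w z := by
    unfold m1 at hm1
    rw [le_div_iff₀ hN1, hNpow, hNT, ← exp_add] at hm1
    refine le_trans (le_of_eq ?_) hm1
    congr 1; ring
  have hW0 : 0 < ∑ z, w z := (exp_pos _).trans_le hW
  have hκ : (∑ x, w x ^ 2) / (∑ x, w x) ≤ C * T ^ δ + 1 := by
    have : m2 w / m1 w = (∑ x, w x ^ 2) / (∑ x, w x) := by
      unfold m1 m2
      field_simp
    rw [← this]
    linarith
  set B := exp ((1 / 2 - ε) * T) with hB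
  set O := exp ((1 / 2 - ε / 2) * T) with hO
  set q := exp (ε / 4 * T) with hq
  set lam := Real.sqrt (T / U) with hlamdef
  have hlamsq : lam ^ 2 = T / U := Real.sq_sqrt (by positivity)
  have hlam1 : 1 ≤ lam := by
    rw [hlamdef, Real.one_le_sqrt, le_div_iff₀ hU0]
    linarith
  set l := ⌈c * (T / U)⌉₊ with hl
  have hc0 : 0 < c := by positivity
  have hB1 : B + 1 ≤ exp T := by
    have h1 : B ≤ exp (T / 2) := by
      apply exp_le_exp.2; nlinarith
    have h2 : exp T = exp (T / 2) * exp (T / 2) := by rw [← exp_add]; congr 1; ring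
    have h3 := add_one_le_exp (T / 2)
    nlinarith
  have hBW : B / ∑ x, w x ≤ exp (-(T / 2)) := by
    rw [div_le_iff₀ hW0]
    refine le_trans (le_of_eq ?_) (mul_le_mul_of_nonneg_left hW (exp_pos _).le)
    rw [← exp_add, hB]; congr 1; ring
  have key1 : T * exp (8 * T / T ^ ((5 : ℝ) / 12)) ≤ exp (ε / 4 * T) := by
    nth_rewrite 1 [hTU]
    rw [← exp_add]
    exact exp_le_exp.2 a2
  have main := good_event hw r k l hr ?_ q O B (C * T ^ δ + 1) T (T ^ ((5 : ℝ) / 12)) lam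
    (T ^ ((1 : ℝ) / 10)) (T ^ ((1 : ℝ) / 5)) (10 * (ν + 2) * (T / U)) U ν T hNT ?_ ?_ ?_ hT0.le hκ
    ?_ a4' ?_ ?_ ?_ ?_ ?_ a6 hlam1 ?_ ?_ (by positivity) ?_ hU0.le (by positivity) ?_ hT0.le ?_
    a7 a8 ?_ ?_
  · rw [hNpow]
    have e1 : -ν * T = -(ν * T) := by ring
    rw [e1]
    refine main.trans ?_
    have := grg_prob hw
    refine measureReal_mono ?_
    intro ω hω
    rw [Set.mem_ofPred_eq] at hω ⊢
    refine hω.trans ?_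
    rw [← hlamsq]
    exact lam_bound hlam1 (Nat.cast_nonneg k)
  · -- 1 ≤ l
    exact Nat.one_le_iff_ne_zero.2 (Nat.ceil_pos.2 (by positivity)).ne'
  · exact one_le_exp (by positivity)
  · exact one_le_exp (mul_nonneg (by linarith) hT0.le)
  · intro x
    have := hA1 x
    rwa [hNpow] at this
  · have : 0 ≤ C * T ^ δ := by positivity
    linarith
  · linarith
  · -- B (κ+1) ≤ O
    have e1 : O = B * exp (ε / 2 * T) := by
      rw [hB, hO, ← exp_add]; congr 1; ring
    rw [e1]
    gcongr
    linarith
  · calc T * (B / ∑ x, w x) * q * O * exp (8 * T / T ^ ((5 : ℝ) / 12))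
        = (T * exp (8 * T / T ^ ((5 : ℝ) / 12))) * (B / ∑ x, w x) * q * O := by ring
      _ ≤ exp (ε / 4 * T) * exp (-(T / 2)) * q * O := by gcongr
      _ = 1 := by
        rw [hq, hO, ← exp_add, ← exp_add, ← exp_add]
        rw [exp_eq_one_iff]; ring
  · calc T * (B * (B / ∑ x, w x)) * q * exp (8 * T / T ^ ((5 : ℝ) / 12))
        = (T * exp (8 * T / T ^ ((5 : ℝ) / 12))) * (B / ∑ x, w x) * q * B := by ring
      _ ≤ exp (ε / 4 * T) * exp (-(T / 2)) * q * B := by gcongr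
      _ ≤ 1 := by
        rw [hq, hB, ← exp_add, ← exp_add, ← exp_add]
        rw [exp_le_one_iff]; nlinarith
  · have := Nat.ceil_lt_add_one (by positivity : 0 ≤ c * (T / U))
    linarith
  · -- hp1
    have hlam0 : 0 < lam := by linarith
    have hratio : T ^ ((5 : ℝ) / 12) ≤ exp (-(U / 24)) * lam := by
      have h1 : exp (11 / 24 * U) ≤ lam := by
        rw [hlamdef]
        apply Real.le_sqrt_of_sq_le
        rw [le_div_iff₀ hU0, ← exp_nat_mul]
        calc exp (((2 : ℕ) : ℝ) * (11 / 24 * U)) * U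
            ≤ exp (((2 : ℕ) : ℝ) * (11 / 24 * U)) * T ^ ((1 : ℝ) / 12) := by gcongr
          _ = T := by
            rw [hTpow, ← exp_add]
            refine Eq.trans ?_ hTU.symm
            congr 1
            push_cast; ring
      calc T ^ ((5 : ℝ) / 12) = exp (-(U / 24)) * exp (11 / 24 * U) := by
            rw [hTpow, ← exp_add]; congr 1; ring
        _ ≤ _ := by gcongr
    have hpow : (T ^ ((5 : ℝ) / 12)) ^ l ≤ exp (-((ν + 3) * T)) * lam ^ l := by
      calc (T ^ ((5 : ℝ) / 12)) ^ l ≤ (exp (-(U / 24)) * lam) ^ l := by gcongr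
        _ = exp (l * -(U / 24)) * lam ^ l := by rw [mul_pow, ← exp_nat_mul]
        _ ≤ _ := by
          gcongr
          have h1 : c * (T / U) ≤ l := Nat.le_ceil _
          have h2 : c * (T / U) * (U / 24) ≤ l * (U / 24) := by gcongr
          have h3 : c * (T / U) * (U / 24) = (ν + 3) * T := by
            rw [hc]; field_simp
          linarith
    have hΛT : T ^ ((5 : ℝ) / 12) ≤ exp T := by
      rw [hTpow]; apply exp_le_exp.2; linarith
    rw [hNT]
    calc exp T * ((B + 1) * (T ^ ((5 : ℝ) / 12)) ^ (l + 1) / lam ^ l)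
        = exp T * (B + 1) * T ^ ((5 : ℝ) / 12) * ((T ^ ((5 : ℝ) / 12)) ^ l / lam ^ l) := by
          rw [pow_succ]; ring
      _ ≤ exp T * exp T * exp T * exp (-((ν + 3) * T)) := by
          gcongr
          rw [div_le_iff₀ (by positivity)]
          exact hpow
      _ = exp (-(ν * T)) := by
          rw [← exp_add, ← exp_add, ← exp_add]; congr 1; ring
  · -- hp2
    have hΛM : (T ^ ((5 : ℝ) / 12)) ^ ((2 * r + 1) * k) ≤ exp T := by
      rw [hTpow, ← exp_nat_mul]
      exact exp_le_exp.2 a10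
    have hqk : exp ((ν + 3) * T) ≤ q ^ k := by
      rw [hq, ← exp_nat_mul]
      apply exp_le_exp.2
      have h1 : 4 * (ν + 3) / ε ≤ k := Nat.le_ceil _
      rw [div_le_iff₀ hε] at h1
      nlinarith
    rw [hNT]
    calc exp T * ((B + 1) * (T ^ ((5 : ℝ) / 12)) ^ ((2 * r + 1) * k) / q ^ k)
        ≤ exp T * (exp T * exp T / exp ((ν + 3) * T)) := by gcongr
      _ = exp (-(ν * T)) := by
          rw [← exp_add, ← exp_sub, ← exp_add]; congr 1; ring
  · -- 1 ≤ log (1+θ)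
    have h1 : U / 10 ≤ Real.log (1 + T ^ ((1 : ℝ) / 10)) := by
      rw [Real.le_log_iff_exp_le (by positivity), hTpow]
      have : exp (U / 10) = exp (1 / 10 * U) := by congr 1; ring
      rw [this]; linarith
    linarith
  · have h1 : U / 10 ≤ Real.log (1 + T ^ ((1 : ℝ) / 10)) := by
      rw [Real.le_log_iff_exp_le (by positivity), hTpow]
      have : exp (U / 10) = exp (1 / 10 * U) := by congr 1; ring
      rw [this]; linarith
    calc (ν + 2) * T = U / 10 * (10 * (ν + 2) * (T / U)) := by field_simp
      _ ≤ _ := by gcongr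
  · have : U * (10 * (ν + 2) * (T / U)) = 10 * (ν + 2) * T := by field_simp
    rw [this]
    nlinarith
  · intro y z
    refine le_trans ?_ hW
    have h1 := hA1 y
    have h2 := hA1 z
    rw [hNpow] at h1 h2
    calc w y * w z ≤ B * B := mul_le_mul h1 h2 (hw z).le (exp_pos _).le
      _ = exp ((1 - 2 * ε) * T) := by rw [hB, ← exp_add]; congr 1; ring
      _ ≤ _ := by apply exp_le_exp.2; nlinarith
  · intro x
    have h1 := hA1 x
    rw [hNpow] at h1
    have h2 : exp ((1 - ε) * T) = B * exp (T / 2) := by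
      rw [hB, ← exp_add]; congr 1; ring
    have h3 := add_one_le_exp (T / 2)
    have h4 : B * 2 ≤ B * exp (T / 2) := by gcongr; linarith
    have h5 : w x ≤ B := h1
    linarith

end GRGAux

open GRG in
/-- Operator-norm error of the pruning.
Under (A1) and (A2), for every `ν > 0` there is `C_ν > 0` such that with `ν`-high
probability `‖A − A^p‖ ≤ C_ν √(log N / log log N)`. -/
theorem opNorm_pruning_error
    (ε δ : ℝ) (hε : 0 < ε) (hε' : ε < 1 / 2) (hδ : 0 < δ) (hδ' : δ < 1 / 3)
    (r : ℕ) (hr : 6 ≤ r)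
    (w : (N : ℕ) → Fin N → ℝ)
    (hpos : ∀ N x, 0 < w N x)
    (hA1 : ∀ N x, w N x ≤ (N : ℝ) ^ ((1 : ℝ) / 2 - ε))
    (hA2m1 : ∀ N : ℕ, 1 ≤ N → (N : ℝ) ^ (-ε) ≤ m1 (w N))
    (hA2m2 : ∃ C > 0, ∀ N : ℕ, 2 ≤ N → m2 (w N) / m1 (w N) ≤ C * Real.log N ^ δ)
    (ν : ℝ) (hν : 0 < ν) :
    ∃ Cν > (0 : ℝ), ∃ C > (0 : ℝ), ∀ N : ℕ,
      1 - ENNReal.ofReal (C * (N : ℝ) ^ (-ν)) ≤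
        grgMeasure (w N) {ω |
          opNorm (adjMatrix ω - adjMatrixPA (Adj ω) r) ≤
            Cν * Real.sqrt (Real.log N / Real.log (Real.log N))} := by
  obtain ⟨K, hK, hm2⟩ := hA2m2
  obtain ⟨Cν, hCν, C', hC', N0, hmain⟩ :=
    GRGAux.good_large ε δ K ν hε hε' hδ' hK hν r (by omega)
  have hbase : (0 : ℝ) < (N0 : ℝ) + 2 := by positivity
  have hpw : (0 : ℝ) < ((N0 : ℝ) + 2) ^ ν := Real.rpow_pos_of_pos hbase ν
  refine ⟨Cν, hCν, C' + ((N0 : ℝ) + 2) ^ ν, by positivity, fun N => ?_⟩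
  haveI : IsProbabilityMeasure (grgMeasure (w N)) := GRGAux.grg_prob (hpos N)
  rcases Nat.eq_zero_or_pos N with h0 | hN
  · subst h0
    have huniv : {ω : EdgeIdx 0 → Bool |
          opNorm (adjMatrix ω - adjMatrixPA (Adj ω) r) ≤
            Cν * Real.sqrt (Real.log (0 : ℕ) / Real.log (Real.log (0 : ℕ)))} = Set.univ := by
      refine Set.eq_univ_of_forall fun ω => ?_
      have hz : adjMatrix ω - adjMatrixPA (Adj ω) r = 0 := Subsingleton.elim _ _
      have hn : opNorm (adjMatrix ω - adjMatrixPA (Adj ω) r) = 0 := by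
        rw [hz]
        simp [opNorm]
      simp only [Set.mem_setOf_eq]
      rw [hn]
      positivity
    rw [huniv, measure_univ]
    exact tsub_le_self
  · have hNR : (0 : ℝ) < (N : ℝ) := by exact_mod_cast hN
    have hNν : (0 : ℝ) < (N : ℝ) ^ (-ν) := Real.rpow_pos_of_pos hNR _
    by_cases hs : N < N0 + 2
    · have h1 : (1 : ℝ) ≤ (C' + ((N0 : ℝ) + 2) ^ ν) * (N : ℝ) ^ (-ν) := by
        have hle : (N : ℝ) ^ ν ≤ ((N0 : ℝ) + 2) ^ ν := by
          apply Real.rpow_le_rpow hNR.le _ hν.le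
          exact_mod_cast hs.le
        have heq : (N : ℝ) ^ ν * (N : ℝ) ^ (-ν) = 1 := by
          rw [← Real.rpow_add hNR]
          simp
        nlinarith [mul_pos hC' hNν, mul_le_mul_of_nonneg_right hle hNν.le]
      have h2 : (1 : ENNReal) ≤ ENNReal.ofReal ((C' + ((N0 : ℝ) + 2) ^ ν) * (N : ℝ) ^ (-ν)) := by
        rw [← ENNReal.ofReal_one]
        exact ENNReal.ofReal_le_ofReal h1
      rw [tsub_eq_zero_of_le h2]
      exact zero_le
    · have h := hmain N (by omega) (w N) (hpos N) (hA1 N) (hA2m1 N hN) (hm2 N (by omega))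
      have h3 : 1 - (C' + ((N0 : ℝ) + 2) ^ ν) * (N : ℝ) ^ (-ν) ≤ 1 - C' * (N : ℝ) ^ (-ν) := by
        nlinarith [mul_pos hpw hNν]
      have h4 := ENNReal.ofReal_le_ofReal (h3.trans h)
      rw [ofReal_measureReal, ENNReal.ofReal_sub _ (by positivity), ENNReal.ofReal_one] at h4
      exact h4
end
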